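/- arXiv:2405.07785 — 5 statements merged into one kernel-verified Lean document; each statement's English description precedes it below -/
import Mathlib

section
/- Let g, r : ℕ → (0,∞) satisfy g_n → ∞ and c·g_n ≤ r_n ≤ e·g_n for all n, for some c ∈ (0,e). Fix ρ ∈ (0,1) and set S_n := [ g_n^{−(1+3ρ)}, g_n^{1+ρ} ]. Let X̃ ~ Gam(1/2, 2g_n), let X := ⌈ X̃|_{S_n} ⌉ (truncation to S_n followed by rounding up to the nearest integer), and let Z | X = x ~ Poisson((r_n/g_n)·x). Then for every ε > 0 there exists n₀ (depending on c, ρ and the sequence g) such that for all n ≥ n₀, I(X;Z) ≥ (1/2)·log r_n − Ψ(r_n/g_n) − ε. -/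
open Filter Set MeasureTheory ProbabilityTheory

/-- The Poisson pmf with (real) mean `lam`. -/
noncomputable def poissonPMFr (lam : ℝ) (z : ℕ) : ℝ :=
  Real.exp (-lam) * lam ^ z / (z.factorial : ℝ)

/-- Output marginal of the single-letter Poisson channel `Z | X = x ~ Poi(a x)`
with input pmf `P` on `ℕ`. -/
noncomputable def outMarg (a : ℝ) (P : ℕ → ℝ) (z : ℕ) : ℝ :=
  ∑' x : ℕ, P x * poissonPMFr (a * x) z

/-- Mutual information (in nats) of the single-letter Poisson channel
`Z | X = x ~ Poi(a x)` with input pmf `P` on `ℕ`. -/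
noncomputable def discMI (a : ℝ) (P : ℕ → ℝ) : ℝ :=
  ∑' x : ℕ, ∑' z : ℕ, P x * poissonPMFr (a * x) z *
    Real.log (poissonPMFr (a * x) z / outMarg a P z)

/-- The law of `Gam(1/2, 2g)` (shape 1/2, scale `2g`, i.e. rate `1/(2g)`). -/
noncomputable def gammaHalf (g : ℝ) : Measure ℝ :=
  gammaMeasure (1 / 2) (1 / (2 * g))

/-- The pmf of `⌈A|_S⌉`: the random variable `A ~ μ` truncated to `S` and then
rounded up to the nearest integer. -/
noncomputable def truncCeilPMF (μ : Measure ℝ) (S : Set ℝ) (k : ℕ) : ℝ :=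
  ((μ[|S]) {u | ⌈u⌉₊ = k}).toReal

/-- Binary entropy (natural logarithm). -/
noncomputable def binEnt (p : ℝ) : ℝ := -p * Real.log p - (1 - p) * Real.log (1 - p)

/-- `Ψ(μ) = (μ+1) h_b(1/(μ+1))`. -/
noncomputable def Psi (μ : ℝ) : ℝ := (μ + 1) * binEnt (1 / (μ + 1))



lemma hasSum_congr_real {f h : ℕ → ℝ} {s : ℝ} (e : ∀ z, f z = h z) : HasSum f s ↔ HasSum h s := by
  rw [funext e]

lemma unimodal_sum (f : ℝ → ℝ) (m : ℝ) (hm : 0 ≤ m) (hf0 : ∀ x, 0 ≤ x → 0 ≤ f x)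
    (hmono : MonotoneOn f (Set.Icc 0 m)) (hanti : AntitoneOn f (Set.Ici m))
    (hint : IntegrableOn f (Set.Ioi 0)) (n : ℕ) :
    ∑ i ∈ Finset.range n, f i ≤ (∫ x in Set.Ioi (0:ℝ), f x) + 2 * f m := by
  set k := ⌊m⌋₊ with hk
  have hkm : (k:ℝ) ≤ m := Nat.floor_le hm
  have hmk : m < k + 1 := Nat.lt_floor_add_one m
  have h1 : ∑ i ∈ Finset.range k, f i ≤ ∫ x in (0:ℝ)..k, f x := by
    have := MonotoneOn.sum_le_integral (f := f) (x₀ := 0) (a := k)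
      (hmono.mono (by intro x hx; simp at hx; exact ⟨hx.1, hx.2.trans hkm⟩))
    simpa using this
  have h2 : ∑ i ∈ Finset.range n, f (k + 2 + i) ≤ ∫ x in ((k:ℝ)+1)..(k+1+n), f x := by
    have := AntitoneOn.sum_le_integral (f := f) (x₀ := (k:ℝ)+1) (a := n)
      (hanti.mono (by intro x hx; simp at hx ⊢; linarith [hx.1]))
    refine le_trans (le_of_eq ?_) this
    apply Finset.sum_congr rfl
    intro i _
    congr 1
    push_cast; ring
  have h3 : f k ≤ f m := hmono ⟨by positivity, hkm⟩ ⟨hm, le_rfl⟩ hkm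
  have h4 : f (k+1) ≤ f m := hanti (Set.mem_Ici.2 le_rfl) (Set.mem_Ici.2 hmk.le) hmk.le
  have h5 : ∑ i ∈ Finset.range n, f i ≤ ∑ i ∈ Finset.range (k + 2 + n), f i := by
    apply Finset.sum_le_sum_of_subset_of_nonneg
    · intro x hx; simp at hx ⊢; omega
    · intro i _ _; exact hf0 _ (by positivity)
  have h6 : ∑ i ∈ Finset.range (k + 2 + n), f i =
      ∑ i ∈ Finset.range k, f i + f k + f (k+1) + ∑ i ∈ Finset.range n, f (k + 2 + i) := by
    rw [Finset.sum_range_add, Finset.sum_range_succ, Finset.sum_range_succ]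
    push_cast
    rfl
  have hk0 : (0:ℝ) ≤ k := by positivity
  have hn0 : (0:ℝ) ≤ n := by positivity
  have h7 : (∫ x in (0:ℝ)..k, f x) + (∫ x in ((k:ℝ)+1)..(k+1+n), f x)
      ≤ ∫ x in Set.Ioi (0:ℝ), f x := by
    rw [intervalIntegral.integral_of_le hk0, intervalIntegral.integral_of_le (by linarith)]
    rw [← setIntegral_union]
    · apply setIntegral_mono_set hint
      · filter_upwards [ae_restrict_mem measurableSet_Ioi] with x hx
        exact hf0 _ (le_of_lt hx)
      · apply Filter.Eventually.of_forall
        intro x hx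
        rcases hx with hx | hx
        · exact hx.1
        · exact lt_of_le_of_lt (by positivity) hx.1
    · rw [Set.disjoint_left]; intro x hx hy; linarith [hx.2, hy.1]
    · exact measurableSet_Ioc
    · exact hint.mono_set (fun x hx => hx.1)
    · exact hint.mono_set (fun x hx => lt_of_le_of_lt (by positivity) hx.1)
  linarith

lemma gauss_sum (l : ℝ) (hl : 0 < l) (n : ℕ) :
    ∑ i ∈ Finset.range n, Real.exp (-((i:ℝ) - l)^2 / (2*l)) ≤ Real.sqrt (2 * Real.pi * l) + 2 := by
  have hI : Integrable (fun x : ℝ => Real.exp (-(x - l)^2 / (2*l))) := by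
    have := (integrable_exp_neg_mul_sq (b := 1/(2*l)) (by positivity)).comp_sub_right l
    refine this.congr (Filter.Eventually.of_forall fun x => ?_)
    simp only
    congr 1; ring
  have h := unimodal_sum (fun x => Real.exp (-(x - l)^2 / (2*l))) l hl.le
    (fun x _ => (Real.exp_pos _).le) ?_ ?_ hI.integrableOn n
  · refine h.trans ?_
    have h1 : ∫ x in Set.Ioi (0:ℝ), Real.exp (-(x - l)^2 / (2*l)) ≤
        ∫ x, Real.exp (-(x - l)^2 / (2*l)) :=
      setIntegral_le_integral hI (Filter.Eventually.of_forall fun x => (Real.exp_pos _).le)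
    have h2 : ∫ x, Real.exp (-(x - l)^2 / (2*l)) = Real.sqrt (2 * Real.pi * l) := by
      have := integral_gaussian (1/(2*l))
      rw [← integral_sub_right_eq_self _ l] at this
      rw [show Real.pi / (1/(2*l)) = 2 * Real.pi * l by rw [div_div_eq_mul_div]; ring] at this
      rw [← this]
      congr 1; ext x; congr 1; ring
    simp only [sub_self]
    norm_num
    linarith
  · intro x hx y hy hxy
    apply Real.exp_le_exp.2
    apply div_le_div_of_nonneg_right _ (by positivity)
    nlinarith [hx.2, hy.2]
  · intro x hx y hy hxy
    simp at hx hy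
    apply Real.exp_le_exp.2
    apply div_le_div_of_nonneg_right _ (by positivity)
    nlinarith

lemma T_bound (b : ℝ) (hb : 0 < b) (z n : ℕ) :
    ∑ i ∈ Finset.range n, (i:ℝ)^z * Real.exp (-b * i) ≤
      z.factorial / b^(z+1) * (1 + 2 * b / Real.sqrt (z+1)) := by
  have hI := Real.integral_rpow_mul_exp_neg_mul_Ioi (a := (z:ℝ)+1) (r := b) (by positivity) hb
  have hII : IntegrableOn (fun x : ℝ => x^z * Real.exp (-b * x)) (Set.Ioi 0) := by
    have := integrableOn_rpow_mul_exp_neg_mul_rpow (p := 1) (s := (z:ℝ)) (b := b)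
      (by have : (0:ℝ) ≤ z := by positivity
          linarith) one_pos hb
    refine this.congr_fun (fun x hx => ?_) measurableSet_Ioi
    simp
  have hval : ∫ x in Set.Ioi (0:ℝ), x^z * Real.exp (-b * x) = z.factorial / b^(z+1) := by
    have e : ∫ x in Set.Ioi (0:ℝ), x^z * Real.exp (-b * x) =
        ∫ t in Set.Ioi (0:ℝ), t ^ ((z:ℝ) + 1 - 1) * Real.exp (-(b * t)) := by
      apply setIntegral_congr_fun measurableSet_Ioi
      intro x hx
      simp
    rw [e, hI, Real.Gamma_nat_eq_factorial]
    rw [show ((z:ℝ)+1) = ((z+1 : ℕ):ℝ) by push_cast; ring, Real.rpow_natCast]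
    rw [one_div, inv_pow]; field_simp
  have hderiv : ∀ x : ℝ, HasDerivAt (fun x : ℝ => x^z * Real.exp (-b * x))
      ((z * x^(z-1) - b * x^z) * Real.exp (-b * x)) x := by
    intro x
    have h1 := (hasDerivAt_pow z x)
    have h2 : HasDerivAt (fun x : ℝ => Real.exp (-b * x)) (Real.exp (-b*x) * (-b)) x := by
      have := ((hasDerivAt_id x).const_mul (-b)).exp
      simpa using this
    refine (h1.mul h2).congr_deriv ?_
    ring
  have hsign : ∀ x : ℝ, 0 < x → (z * x^(z-1) - b * x^z) = x^z / x * (z - b * x) := by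
    intro x hx
    rcases z with _ | k
    · simp; field_simp
    · simp only [Nat.add_sub_cancel]
      rw [pow_succ]; field_simp
  have hcont : Continuous (fun x : ℝ => x^z * Real.exp (-b * x)) := by fun_prop
  have h := unimodal_sum (fun x => x^z * Real.exp (-b * x)) (z/b) (by positivity)
    (fun x hx => by positivity) ?_ ?_ hII n
  · refine h.trans ?_
    rw [hval]
    have hs := Stirling.le_factorial_stirling z
    have hk : Real.sqrt (z+1) * ((z:ℝ) / Real.exp 1)^z ≤ z.factorial := by
      rcases Nat.eq_zero_or_pos z with rfl | hz
      · simp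
      · refine le_trans ?_ hs
        apply mul_le_mul_of_nonneg_right _ (by positivity)
        apply Real.sqrt_le_sqrt
        have : (1:ℝ) ≤ z := by exact_mod_cast hz
        nlinarith [Real.pi_gt_three]
    have e1 : Real.exp (-b * (z / b)) = (Real.exp 1)⁻¹ ^ z := by
      rw [← Real.exp_neg, ← Real.exp_nat_mul]; congr 1; field_simp
    rw [e1]
    have e2 : ((z:ℝ)/b)^z * (Real.exp 1)⁻¹^z = ((z:ℝ) / Real.exp 1)^z / b^z := by
      rw [div_pow, div_pow, inv_pow]; field_simp
    rw [e2]
    have hsq : 0 < Real.sqrt ((z:ℝ)+1) := Real.sqrt_pos.2 (by positivity)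
    have h3 : ((z:ℝ) / Real.exp 1)^z ≤ z.factorial / Real.sqrt (z+1) := by
      rw [le_div_iff₀ hsq]; linarith
    have h4 : ((z:ℝ) / Real.exp 1)^z / b^z ≤ z.factorial / Real.sqrt (z+1) / b^z := by gcongr
    have e3 : (z.factorial:ℝ) / b^(z+1) * (1 + 2 * b / Real.sqrt (z+1)) =
       z.factorial / b^(z+1) + 2 * (z.factorial / Real.sqrt (z+1) / b^z) := by
      rw [pow_succ]; field_simp
    rw [e3]; linarith
  · apply monotoneOn_of_deriv_nonneg (convex_Icc _ _) hcont.continuousOn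
    · intro x _; exact (hderiv x).differentiableAt.differentiableWithinAt
    · intro x hx
      rw [interior_Icc] at hx
      rw [(hderiv x).deriv, hsign x hx.1]
      have : 0 ≤ z - b * x := by
        have := hx.2.le
        rw [le_div_iff₀ hb] at this; linarith
      have := hx.1
      positivity
  · apply antitoneOn_of_deriv_nonpos (convex_Ici _) hcont.continuousOn
    · intro x _; exact (hderiv x).differentiableAt.differentiableWithinAt
    · intro x hx
      rw [interior_Ici] at hx
      have hx : (z:ℝ)/b < x := hx
      have hx0 : 0 < x := lt_of_le_of_lt (by positivity) hx
      rw [(hderiv x).deriv, hsign x hx0]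
      have : z - b * x ≤ 0 := by
        rw [div_lt_iff₀ hb] at hx; linarith
      apply mul_nonpos_of_nonpos_of_nonneg _ (Real.exp_pos _).le
      exact mul_nonpos_of_nonneg_of_nonpos (by positivity) this

lemma poi_pos (l : ℝ) (hl : 0 < l) (z : ℕ) : 0 < poissonPMFr l z := by
  unfold poissonPMFr; positivity

lemma poi_sum (l : ℝ) : HasSum (poissonPMFr l) 1 := by
  have := (NormedSpace.expSeries_div_hasSum_exp l).mul_left (Real.exp (-l))
  rw [← Real.exp_eq_exp_ℝ, ← Real.exp_add] at this
  simp only [neg_add_cancel, Real.exp_zero] at this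
  refine (hasSum_congr_real fun z => ?_).2 this
  unfold poissonPMFr; ring

lemma poi_succ (l : ℝ) (z : ℕ) : ((z:ℝ)+1) * poissonPMFr l (z+1) = l * poissonPMFr l z := by
  unfold poissonPMFr
  rw [Nat.factorial_succ, pow_succ]; push_cast; field_simp

lemma poi_mean (l : ℝ) : HasSum (fun z : ℕ => (z:ℝ) * poissonPMFr l z) l := by
  rw [← hasSum_nat_add_iff' 1]
  simp only [Finset.sum_range_one, Nat.cast_zero, zero_mul, sub_zero]
  have := (poi_sum l).mul_left l
  rw [mul_one] at this
  refine (hasSum_congr_real fun z => ?_).2 this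
  push_cast; rw [poi_succ]

lemma poi_fact2 (l : ℝ) : HasSum (fun z : ℕ => (z:ℝ) * (z-1) * poissonPMFr l z) (l^2) := by
  rw [← hasSum_nat_add_iff' 1]
  simp only [Finset.sum_range_one, Nat.cast_zero, zero_mul, sub_zero]
  have := (poi_mean l).mul_left l
  rw [← sq] at this
  refine (hasSum_congr_real fun z => ?_).2 this
  push_cast; 
  have := poi_succ l z
  linear_combination (z:ℝ) * this

lemma poi_var (l : ℝ) : HasSum (fun z : ℕ => ((z:ℝ) - l)^2 * poissonPMFr l z) l := by
  have := ((poi_fact2 l).add ((poi_mean l).mul_left (1 - 2 * l))).add ((poi_sum l).mul_left (l^2))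
  rw [show l^2 + (1 - 2*l)*l + l^2 * 1 = l by ring] at this
  refine (hasSum_congr_real fun z => ?_).2 this
  ring

lemma poi_inv (l : ℝ) (hl : 0 < l) :
    HasSum (fun z : ℕ => poissonPMFr l z / ((z:ℝ)+1)) ((1 - Real.exp (-l))/l) := by
  have := ((hasSum_nat_add_iff' 1).2 (poi_sum l)).div_const l
  simp only [Finset.sum_range_one] at this
  have e : poissonPMFr l 0 = Real.exp (-l) := by simp [poissonPMFr]
  rw [e] at this
  refine (hasSum_congr_real fun z => ?_).2 this
  have := poi_succ l z
  field_simp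
  linarith

lemma aux_poly (s : ℝ) (h0 : 0 ≤ s) (h1 : s ≤ 1) :
    (1 + 2 * s) * ((1 + 8 * s) * (1 + 340 * s)) ≤ (1 + 400 * s)^2 := by
  have h2 : 0 ≤ s^2 * (1 - s) := mul_nonneg (sq_nonneg _) (by linarith)
  nlinarith [sq_nonneg s]

set_option maxHeartbeats 1000000 in
lemma sum_w (b c : ℝ) (hc : 0 < c) (hcb : c ≤ b) (hb4 : b ≤ 4) (w : ℕ → ℝ) (hw0 : ∀ i, 0 ≤ w i)
    (hw2 : ∀ i, w i ≤ 2) (hw : ∀ i : ℕ, w i ^ 2 * (i:ℝ)^2 ≤ i + 3) (z n : ℕ) :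
    ∑ i ∈ Finset.range n, w i * ((i:ℝ)^z * Real.exp (-b * i)) ≤
      z.factorial / (b^z * Real.sqrt b) *
        (1 / Real.sqrt (z+1) * (1 + (400 + 36 / Real.sqrt c) * (1 / Real.sqrt (z+1)))) := by
  have hb : 0 < b := lt_of_lt_of_le hc hcb
  have hsb : 0 < Real.sqrt b := Real.sqrt_pos.2 hb
  have hsc : 0 < Real.sqrt c := Real.sqrt_pos.2 hc
  have hsbc : Real.sqrt c ≤ Real.sqrt b := Real.sqrt_le_sqrt hcb
  have hsb2 : Real.sqrt b ^ 2 = b := Real.sq_sqrt hb.le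
  have hz0 : (0:ℝ) ≤ z := by positivity
  have hsq : 0 < Real.sqrt ((z:ℝ)+1) := Real.sqrt_pos.2 (by positivity)
  have hsq1 : 1 ≤ Real.sqrt ((z:ℝ)+1) := by
    rw [Real.one_le_sqrt]; linarith
  have hsq2 : Real.sqrt ((z:ℝ)+1)^2 = z + 1 := Real.sq_sqrt (by positivity)
  have hTz := T_bound b hb z n
  set s := 1 / Real.sqrt ((z:ℝ)+1) with hs
  have hs0 : 0 < s := by positivity
  have hs1 : s ≤ 1 := by rw [hs, div_le_one hsq]; exact hsq1
  have hs2 : s^2 = 1 / ((z:ℝ)+1) := by rw [hs, div_pow, hsq2]; simp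
  have hTz' : ∑ i ∈ Finset.range n, (i:ℝ)^z * Real.exp (-b * i) ≤
      z.factorial / b^(z+1) * (1 + 8 * s) := by
    refine hTz.trans ?_
    have : 2 * b / Real.sqrt ((z:ℝ)+1) = 2 * b * s := by rw [hs]; ring
    rw [this]
    gcongr
    linarith
  have hC : 0 < 36 / Real.sqrt c := by positivity
  by_cases hz : z ≤ 1
  · have h1 : ∑ i ∈ Finset.range n, w i * ((i:ℝ)^z * Real.exp (-b * i)) ≤
        ∑ i ∈ Finset.range n, 2 * ((i:ℝ)^z * Real.exp (-b * i)) := by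
      apply Finset.sum_le_sum
      intro i _
      apply mul_le_mul_of_nonneg_right (hw2 i) (by positivity)
    rw [← Finset.mul_sum] at h1
    have hz1 : (z:ℝ) ≤ 1 := by exact_mod_cast hz
    have hs3 : 1/2 ≤ s^2 := by
      rw [hs2]; apply one_div_le_one_div_of_le <;> linarith
    have h2 : (z.factorial:ℝ) / b^(z+1) * (1 + 8 * s) ≤ z.factorial / b^(z+1) * 9 := by
      gcongr; linarith
    have h3 : (z.factorial:ℝ) / b^(z+1) * 18 = z.factorial / (b^z * Real.sqrt b) * (18 / Real.sqrt b) := by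
      rw [pow_succ]; nth_rewrite 2 [← hsb2]; field_simp
    have h4 : 18 / Real.sqrt b ≤ 18 / Real.sqrt c := by gcongr
    have h5 : 18 / Real.sqrt c ≤ s * (1 + (400 + 36 / Real.sqrt c) * s) := by
      have : 18 / Real.sqrt c = 36 / Real.sqrt c * (1/2) := by ring
      rw [this]
      nlinarith
    calc _ ≤ (z.factorial:ℝ) / b^(z+1) * 18 := by linarith
      _ = _ := h3
      _ ≤ _ := by
        apply mul_le_mul_of_nonneg_left _ (by positivity)
        linarith
  · obtain ⟨k, rfl⟩ : ∃ k, z = k + 2 := ⟨z - 2, by omega⟩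
    have hk0 : (0:ℝ) ≤ k := by positivity
    push_cast at hs2
    have hT1 := T_bound b hb (k+1) n
    have hT0 := T_bound b hb k n
    set D : ℝ := (k+1).factorial / b^(k+2) with hD
    have hD0 : 0 < D := by positivity
    have i1 : 1 / Real.sqrt (((k+1:ℕ):ℝ)+1) ≤ 2 * s := by
      have : (1 / Real.sqrt (((k+1:ℕ):ℝ)+1))^2 ≤ (2 * s)^2 := by
        rw [div_pow, Real.sq_sqrt (by positivity), mul_pow, hs2]
        push_cast
        rw [one_pow, mul_one_div, div_le_div_iff₀ (by positivity) (by positivity)]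
        linarith
      exact le_of_sq_le_sq this (by positivity)
    have hT1' : ∑ i ∈ Finset.range n, (i:ℝ)^(k+1) * Real.exp (-b * i) ≤ D * (1 + 16 * s) := by
      refine hT1.trans ?_
      apply mul_le_mul_of_nonneg_left _ hD0.le
      have : 2 * b / Real.sqrt (((k+1:ℕ):ℝ)+1) = 2 * b * (1 / Real.sqrt (((k+1:ℕ):ℝ)+1)) := by ring
      rw [this]
      nlinarith
    have hT0' : ∑ i ∈ Finset.range n, (i:ℝ)^k * Real.exp (-b * i) ≤ D * (108 * s) := by
      refine hT0.trans ?_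
      have e : (k.factorial:ℝ) / b^(k+1) = D * (b / (k+1)) := by
        rw [hD, Nat.factorial_succ, pow_succ b (k+1)]; push_cast; field_simp
      rw [e, mul_assoc]
      apply mul_le_mul_of_nonneg_left _ hD0.le
      have j1 : b / ((k:ℝ)+1) ≤ 12 * s := by
        have : b / ((k:ℝ)+1) ≤ 12 * s^2 := by
          rw [hs2, mul_one_div, div_le_div_iff₀ (by positivity) (by positivity)]
          nlinarith
        nlinarith
      have j2 : 1 + 2 * b / Real.sqrt ((k:ℝ)+1) ≤ 9 := by
        have : 2 * b / Real.sqrt ((k:ℝ)+1) ≤ 8 := by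
          rw [div_le_iff₀ (Real.sqrt_pos.2 (by positivity))]
          have : 1 ≤ Real.sqrt ((k:ℝ)+1) := by rw [Real.one_le_sqrt]; linarith
          linarith
        linarith
      calc b / ((k:ℝ)+1) * (1 + 2 * b / Real.sqrt ((k:ℝ)+1)) ≤ (12 * s) * 9 := by gcongr
        _ = _ := by ring
    have hB : ∑ i ∈ Finset.range n, w i ^ 2 * ((i:ℝ)^(k+2) * Real.exp (-b * i)) ≤
        D * (1 + 340 * s) := by
      have : ∑ i ∈ Finset.range n, w i ^ 2 * ((i:ℝ)^(k+2) * Real.exp (-b * i)) ≤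
          ∑ i ∈ Finset.range n, ((i:ℝ)^(k+1) * Real.exp (-b * i) +
            3 * ((i:ℝ)^k * Real.exp (-b * i))) := by
        apply Finset.sum_le_sum
        intro i _
        have := mul_le_mul_of_nonneg_right (hw i)
          (show 0 ≤ (i:ℝ)^k * Real.exp (-b * i) by positivity)
        calc _ = w i ^ 2 * (i:ℝ)^2 * ((i:ℝ)^k * Real.exp (-b * i)) := by ring
          _ ≤ _ := this
          _ = _ := by ring
      rw [Finset.sum_add_distrib, ← Finset.mul_sum] at this
      linarith
    have hCS := Finset.sum_sq_le_sum_mul_sum_of_sq_le_mul (Finset.range n)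
      (r := fun i : ℕ => w i * ((i:ℝ)^(k+2) * Real.exp (-b * i)))
      (f := fun i : ℕ => ((i:ℝ)^(k+2) * Real.exp (-b * i)))
      (g := fun i : ℕ => w i ^ 2 * ((i:ℝ)^(k+2) * Real.exp (-b * i)))
      (fun i _ => by positivity) (fun i _ => by positivity) (fun i _ => le_of_eq (by ring))
    have hprod := hCS.trans (mul_le_mul hTz' hB (Finset.sum_nonneg fun i _ => by positivity)
      (by positivity))
    apply le_of_sq_le_sq _ (by positivity)
    refine hprod.trans ?_
    set E : ℝ := (k+2).factorial / (b^(k+2) * Real.sqrt b) with hE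
    have e1 : ((k+2).factorial : ℝ) / b^(k+2+1) * D = E^2 * (1/((k:ℝ)+2)) := by
      rw [hE, hD, div_pow, mul_pow, hsb2, Nat.factorial_succ (k+1)]
      push_cast
      rw [pow_succ b (k+2)]
      field_simp
      ring
    have e2 : 1/((k:ℝ)+2) ≤ s^2 * (1 + 2 * s) := by
      have : 1/((k:ℝ)+2) ≤ s^2 * (1 + 2 * s^2) := by
        rw [hs2]
        rw [div_le_iff₀ (by positivity)]
        have : 1 / ((k:ℝ)+2+1) * (1 + 2 * (1 / ((k:ℝ)+2+1))) * (k+2)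
          = 1 + (k+1) / ((k:ℝ)+3)^2 := by field_simp; ring
        rw [this]
        have : 0 ≤ (k+1) / ((k:ℝ)+3)^2 := by positivity
        linarith
      refine this.trans ?_
      have : s^2 ≤ s := by nlinarith
      gcongr
    calc _ = ((k+2).factorial : ℝ) / b^(k+2+1) * D * ((1 + 8 * s) * (1 + 340 * s)) := by ring
      _ = E^2 * ((1/((k:ℝ)+2)) * ((1 + 8 * s) * (1 + 340 * s))) := by rw [e1]; ring
      _ ≤ E^2 * ((s^2 * (1 + 2 * s)) * ((1 + 8 * s) * (1 + 340 * s))) := by gcongr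
      _ = E^2 * (s^2 * ((1 + 2 * s) * ((1 + 8 * s) * (1 + 340 * s)))) := by ring
      _ ≤ E^2 * (s^2 * (1 + 400 * s)^2) := by
        have : (1 + 2 * s) * ((1 + 8 * s) * (1 + 340 * s)) ≤ (1 + 400 * s)^2 := by
          exact aux_poly s hs0.le hs1
        gcongr
      _ ≤ E^2 * (s^2 * (1 + (400 + 36 / Real.sqrt c) * s)^2) := by
        gcongr
        linarith
      _ = _ := by ring

/-- increments of `2 sqrt` -/
noncomputable def wInc (i : ℕ) : ℝ := 2 * (Real.sqrt i - Real.sqrt ((i:ℝ) - 1))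

lemma wInc_facts (i : ℕ) : 0 ≤ wInc i ∧ wInc i ≤ 2 ∧ wInc i ^ 2 * (i:ℝ)^2 ≤ i + 3 := by
  rcases Nat.eq_zero_or_pos i with rfl | hi
  · have : Real.sqrt (-1) = 0 := Real.sqrt_eq_zero_of_nonpos (by norm_num)
    simp [wInc, this]
  have h1 : (1:ℝ) ≤ i := by exact_mod_cast hi
  unfold wInc
  set p := Real.sqrt i
  set q := Real.sqrt ((i:ℝ)-1)
  have hp : 0 ≤ p := Real.sqrt_nonneg _
  have hq : 0 ≤ q := Real.sqrt_nonneg _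
  have hp2 : p^2 = i := Real.sq_sqrt (by linarith)
  have hq2 : q^2 = i - 1 := Real.sq_sqrt (by linarith)
  have hqp : q ≤ p := Real.sqrt_le_sqrt (by linarith)
  have hpq : (p - q) * (p + q) = 1 := by nlinarith
  refine ⟨by linarith, ?_, ?_⟩
  · nlinarith
  · have h2 : (p-q)^2 * (4 * i - 3) ≤ 1 := by
      have : (4 * (i:ℝ) - 3) ≤ (p+q)^2 := by nlinarith
      calc (p-q)^2 * (4 * i - 3) ≤ (p-q)^2 * (p+q)^2 := by gcongr
        _ = ((p - q) * (p + q))^2 := by ring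
        _ = 1 := by rw [hpq]; norm_num
    have h3 : (p-q)^2 ≤ 1 / (4 * i - 3) := by rw [le_div_iff₀ (by linarith)]; exact h2
    calc (2 * (p-q))^2 * (i:ℝ)^2 = (p-q)^2 * (4 * (i:ℝ)^2) := by ring
      _ ≤ 1 / (4 * i - 3) * (4 * (i:ℝ)^2) := by gcongr
      _ ≤ i + 3 := by
        rw [one_div_mul_eq_div, div_le_iff₀ (by linarith)]
        nlinarith

lemma q_bound (g a c K : ℝ) (P : ℕ → ℝ) (N : ℕ) (hg : 1 ≤ g) (hc : 0 < c) (hca : c ≤ a)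
    (ha3 : a ≤ 3) (hK : 0 < K) (hN : ∀ x, N ≤ x → P x = 0)
    (hP : ∀ x : ℕ, P x ≤ K / Real.sqrt (2 * Real.pi * g) * Real.exp (-(x:ℝ)/(2*g)) * wInc x)
    (z : ℕ) :
    outMarg a P z ≤ K / Real.sqrt (2 * Real.pi * (a * g)) * ((1 + 1/(2*(a*g)))^z)⁻¹ *
      (1 / Real.sqrt (z+1) * (1 + (400 + 36 / Real.sqrt c) * (1 / Real.sqrt (z+1)))) := by
  have ha : 0 < a := lt_of_lt_of_le hc hca
  have hg0 : 0 < g := by linarith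
  set b := a + 1/(2*g) with hb
  have h2g : 1/(2*g) ≤ 1 := by rw [div_le_one (by positivity)]; linarith
  have h2g0 : 0 < 1/(2*g) := by positivity
  have hsum := sum_w b c hc (by linarith) (by linarith) wInc (fun i => (wInc_facts i).1)
    (fun i => (wInc_facts i).2.1) (fun i => (wInc_facts i).2.2) z N
  set Q := (1 / Real.sqrt ((z:ℝ)+1) * (1 + (400 + 36 / Real.sqrt c) * (1 / Real.sqrt ((z:ℝ)+1)))) with hQ
  have hQ0 : 0 ≤ Q := by positivity
  have hb0 : 0 < b := by linarith
  have h1 : outMarg a P z ≤ K / Real.sqrt (2 * Real.pi * g) * (a^z / z.factorial) *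
      ∑ i ∈ Finset.range N, wInc i * ((i:ℝ)^z * Real.exp (-b * i)) := by
    unfold outMarg
    rw [tsum_eq_sum (s := Finset.range N)
      (fun x hx => by rw [hN x (by simpa using hx), zero_mul]), Finset.mul_sum]
    apply Finset.sum_le_sum
    intro x _
    have hp : 0 ≤ poissonPMFr (a * x) z := by unfold poissonPMFr; positivity
    refine (mul_le_mul_of_nonneg_right (hP x) hp).trans (le_of_eq ?_)
    have e : Real.exp (-b * x) = Real.exp (-(x:ℝ)/(2*g)) * Real.exp (-(a * x)) := by
      rw [← Real.exp_add]; congr 1; rw [hb]; ring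
    rw [e]; unfold poissonPMFr; rw [mul_pow]; ring
  have h2 : outMarg a P z ≤ K / Real.sqrt (2 * Real.pi * g) * (a^z / z.factorial) *
      (z.factorial / (b^z * Real.sqrt b) * Q) := h1.trans (by gcongr)
  refine h2.trans ?_
  have e1 : K / Real.sqrt (2 * Real.pi * g) * (a^z / z.factorial) *
      (z.factorial / (b^z * Real.sqrt b) * Q) =
      K / Real.sqrt (2 * Real.pi * g) / Real.sqrt b * (a/b)^z * Q := by
    rw [div_pow]; field_simp
  have e2 : (a/b) = (1 + 1/(2*(a*g)))⁻¹ := by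
    rw [hb]; field_simp
  rw [e1, e2, inv_pow]
  have e3 : Real.sqrt (2 * Real.pi * (a * g)) = Real.sqrt (2 * Real.pi * g) * Real.sqrt a := by
    rw [← Real.sqrt_mul (by positivity)]; congr 1; ring
  rw [e3, ← div_div K]
  have : Real.sqrt a ≤ Real.sqrt b := Real.sqrt_le_sqrt (by linarith)
  have : 0 < Real.sqrt a := Real.sqrt_pos.2 ha
  gcongr

set_option maxHeartbeats 1000000 in
lemma per_x (l r K C δ : ℝ) (q : ℕ → ℝ) (hl : 0 < l) (hr : 0 < r) (hK : 0 < K) (hC : 0 ≤ C)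
    (hδ : 0 < δ) (hlow : ∀ z, δ * poissonPMFr l z ≤ q z)
    (hq : ∀ z : ℕ, q z ≤ K / Real.sqrt (2 * Real.pi * r) * ((1 + 1/(2*r))^z)⁻¹ *
      (1 / Real.sqrt (z+1) * (1 + C * (1 / Real.sqrt (z+1))))) :
    (1/2) * Real.log r - 1/2 - Real.log K + l / (2*r+1) - (C+1) / Real.sqrt l ≤
      ∑' z, poissonPMFr l z * Real.log (poissonPMFr l z / q z) := by
  have hp : ∀ z, 0 < poissonPMFr l z := poi_pos l hl
  have hq0 : ∀ z, 0 < q z := fun z => lt_of_lt_of_le (mul_pos hδ (hp z)) (hlow z)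
  set N := Real.sqrt (2 * Real.pi * l) + 2 with hN
  have hN0 : 0 < N := by positivity
  set Q : ℕ → ℝ := fun z => Real.exp (-((z:ℝ) - l)^2 / (2*l)) / N with hQ
  have hQ0 : ∀ z, 0 < Q z := fun z => by simp only [hQ]; positivity
  have hQpart : ∀ n, ∑ z ∈ Finset.range n, Q z ≤ 1 := by
    intro n
    simp only [hQ]
    rw [← Finset.sum_div, div_le_one hN0]
    exact gauss_sum l hl n
  have hQs : Summable Q := summable_of_sum_range_le (fun z => (hQ0 z).le) hQpart
  have hQ1 : ∑' z, Q z ≤ 1 := hQs.tsum_le_of_sum_range_le hQpart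
  have hsl : 0 < Real.sqrt l := Real.sqrt_pos.2 hl
  have hsl2 : Real.sqrt l ^ 2 = l := Real.sq_sqrt hl.le
  set A0 := - Real.log N + 1 - Real.log K + (1/2) * Real.log (2 * Real.pi * r)
    + (1/2) * Real.log l + 1/2 - C / (2 * Real.sqrt l) with hA0
  set B := l/2 + C * Real.sqrt l / 2 with hB
  set L : ℕ → ℝ := fun z => A0 * poissonPMFr l z + (-1/(2*l)) * (((z:ℝ) - l)^2 * poissonPMFr l z)
    + 1/(2*r+1) * ((z:ℝ) * poissonPMFr l z) - B * (poissonPMFr l z / ((z:ℝ)+1)) - Q z with hL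
  have hLsum : HasSum L (A0 * 1 + (-1/(2*l)) * l + 1/(2*r+1) * l - B * ((1 - Real.exp (-l))/l)
      - ∑' z, Q z) :=
    (((((poi_sum l).mul_left A0).add ((poi_var l).mul_left _)).add ((poi_mean l).mul_left _)).sub
      ((poi_inv l hl).mul_left B)).sub hQs.hasSum
  have hlogq : ∀ z : ℕ, Real.log (q z) ≤ Real.log K - (1/2) * Real.log (2 * Real.pi * r)
      - z / (2*r+1) - (1/2) * Real.log (z+1) + C * (1 / Real.sqrt (z+1)) := by
    intro z
    refine (Real.log_le_log (hq0 z) (hq z)).trans ?_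
    have hz1 : 0 < Real.sqrt ((z:ℝ)+1) := Real.sqrt_pos.2 (by positivity)
    have hpr : 0 < Real.sqrt (2 * Real.pi * r) := by positivity
    rw [Real.log_mul (by positivity) (by positivity), Real.log_mul (by positivity) (by positivity),
      Real.log_mul (by positivity) (by positivity), Real.log_div hK.ne' hpr.ne', Real.log_inv,
      Real.log_pow, Real.log_div one_ne_zero hz1.ne', Real.log_one, Real.log_sqrt (by positivity),
      Real.log_sqrt (by positivity)]
    have h1 : Real.log (1 + C * (1 / Real.sqrt ((z:ℝ)+1))) ≤ C * (1 / Real.sqrt ((z:ℝ)+1)) := by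
      have := Real.log_le_sub_one_of_pos (x := 1 + C * (1 / Real.sqrt ((z:ℝ)+1))) (by positivity)
      linarith
    have h2 : 1/(2*r+1) ≤ Real.log (1 + 1/(2*r)) := by
      have := Real.one_sub_inv_le_log_of_pos (x := 1 + 1/(2*r)) (by positivity)
      refine le_trans (le_of_eq ?_) this
      field_simp
      ring
    have h3 : (z:ℝ) / (2*r+1) ≤ z * Real.log (1 + 1/(2*r)) := by
      have := mul_le_mul_of_nonneg_left h2 (show (0:ℝ) ≤ z by positivity)
      rwa [mul_one_div] at this
    linarith
  have hLle : ∀ z, L z ≤ poissonPMFr l z * Real.log (poissonPMFr l z / q z) := by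
    intro z
    have hpz := hp z
    have hz1 : 0 < Real.sqrt ((z:ℝ)+1) := Real.sqrt_pos.2 (by positivity)
    have hz2 : Real.sqrt ((z:ℝ)+1)^2 = z+1 := Real.sq_sqrt (by positivity)
    have h1 : Real.log (Q z) = -((z:ℝ) - l)^2 / (2*l) - Real.log N := by
      simp only [hQ]
      rw [Real.log_div (Real.exp_pos _).ne' hN0.ne', Real.log_exp]
    have h2 : Real.log (Q z) - Real.log (poissonPMFr l z) ≤ Q z / poissonPMFr l z - 1 := by
      rw [← Real.log_div (hQ0 z).ne' hpz.ne']
      exact Real.log_le_sub_one_of_pos (div_pos (hQ0 z) hpz)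
    have h3 : Real.log l - Real.log ((z:ℝ)+1) ≤ l / ((z:ℝ)+1) - 1 := by
      rw [← Real.log_div hl.ne' (by positivity)]
      exact Real.log_le_sub_one_of_pos (by positivity)
    have h4 : 1 / Real.sqrt ((z:ℝ)+1) ≤ Real.sqrt l / 2 * (1/((z:ℝ)+1)) + 1 / (2 * Real.sqrt l) := by
      have : Real.sqrt l / 2 * (1/Real.sqrt ((z:ℝ)+1)^2) + 1 / (2 * Real.sqrt l) - 1 / Real.sqrt ((z:ℝ)+1)
        = (Real.sqrt l / Real.sqrt ((z:ℝ)+1) - 1)^2 / (2 * Real.sqrt l) := by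
        field_simp
        ring
      rw [hz2] at this
      have h : 0 ≤ (Real.sqrt l / Real.sqrt ((z:ℝ)+1) - 1)^2 / (2 * Real.sqrt l) := by positivity
      linarith
    have h4' := mul_le_mul_of_nonneg_left h4 hC
    rw [Real.log_div hpz.ne' (hq0 z).ne']
    have h5 := hlogq z
    have h6 : A0 + (-1/(2*l)) * ((z:ℝ) - l)^2 + 1/(2*r+1) * (z:ℝ) - B * (1/((z:ℝ)+1))
        - Q z / poissonPMFr l z ≤ Real.log (poissonPMFr l z) - Real.log (q z) := by
      have e1 : (-1/(2*l)) * ((z:ℝ) - l)^2 = -((z:ℝ) - l)^2 / (2*l) := by ring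
      have e2 : 1/(2*r+1) * (z:ℝ) = z / (2*r+1) := by ring
      have e3 : B * (1/((z:ℝ)+1)) = (1/2) * (l / ((z:ℝ)+1)) +
         C * (Real.sqrt l / 2 * (1/((z:ℝ)+1))) := by rw [hB]; ring
      have e4 : C * (Real.sqrt l / 2 * (1/((z:ℝ)+1)) + 1 / (2 * Real.sqrt l)) =
        C * (Real.sqrt l / 2 * (1/((z:ℝ)+1))) + C / (2 * Real.sqrt l) := by ring
      rw [e4] at h4'
      rw [e1, e2, e3, hA0]
      linarith
    have h7 := mul_le_mul_of_nonneg_left h6 hpz.le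
    refine le_trans (le_of_eq ?_) h7
    simp only [hL]
    field_simp
  have hU : ∀ z, poissonPMFr l z * Real.log (poissonPMFr l z / q z) ≤
      Real.log (1/δ) * poissonPMFr l z := by
    intro z
    rw [mul_comm]
    apply mul_le_mul_of_nonneg_right _ (hp z).le
    apply Real.log_le_log (div_pos (hp z) (hq0 z))
    rw [div_le_div_iff₀ (hq0 z) hδ]
    linarith [hlow z]
  have hFs : Summable (fun z => poissonPMFr l z * Real.log (poissonPMFr l z / q z)) := by
    have : Summable (fun z => poissonPMFr l z * Real.log (poissonPMFr l z / q z) - L z) := by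
      apply Summable.of_nonneg_of_le (f := fun z => Real.log (1/δ) * poissonPMFr l z - L z)
      · intro z; linarith [hLle z]
      · intro z; linarith [hU z]
      · exact ((poi_sum l).summable.mul_left _).sub hLsum.summable
    have h := this.add hLsum.summable
    refine h.congr (fun z => ?_)
    ring
  have hge := hLsum.summable.tsum_le_tsum hLle hFs
  rw [hLsum.tsum_eq] at hge
  refine le_trans ?_ hge
  have b1 : B * ((1 - Real.exp (-l))/l) ≤ 1/2 + C / (2 * Real.sqrt l) := by
    have hB0 : 0 ≤ B := by positivity
    have : B * ((1 - Real.exp (-l))/l) ≤ B * (1/l) := by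
      gcongr
      linarith [Real.exp_pos (-l)]
    refine this.trans (le_of_eq ?_)
    rw [hB]
    nth_rewrite 3 [← hsl2]
    field_simp
    linear_combination -hsl2
  have b2 : Real.log N ≤ (1/2) * Real.log (2 * Real.pi * l) + 1 / Real.sqrt l := by
    have hs0 : 0 < Real.sqrt (2 * Real.pi * l) := by positivity
    have e : N = Real.sqrt (2 * Real.pi * l) * (1 + 2 / Real.sqrt (2 * Real.pi * l)) := by
      rw [hN]; field_simp
    rw [e, Real.log_mul hs0.ne' (by positivity), Real.log_sqrt (by positivity)]
    have h1 := Real.log_le_sub_one_of_pos (x := 1 + 2 / Real.sqrt (2 * Real.pi * l)) (by positivity)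
    have h2 : 2 / Real.sqrt (2 * Real.pi * l) ≤ 1 / Real.sqrt l := by
      rw [div_le_div_iff₀ hs0 hsl, one_mul]
      have : 2 * Real.sqrt l = Real.sqrt (4 * l) := by
        rw [Real.sqrt_mul (by norm_num), show (4:ℝ) = 2^2 by norm_num, Real.sqrt_sq (by norm_num)]
      rw [this]
      apply Real.sqrt_le_sqrt
      nlinarith [Real.pi_gt_three]
    linarith
  have b3 : Real.log (2 * Real.pi * l) = Real.log (2 * Real.pi) + Real.log l :=
    Real.log_mul (by positivity) hl.ne'
  have b4 : Real.log (2 * Real.pi * r) = Real.log (2 * Real.pi) + Real.log r :=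
    Real.log_mul (by positivity) hr.ne'
  have b5 : (-1/(2*l)) * l = -1/2 := by field_simp
  have b6 : (C+1) / Real.sqrt l = C / (2 * Real.sqrt l) + C / (2 * Real.sqrt l) + 1 / Real.sqrt l := by
    field_simp; ring
  have b7 : 1/(2*r+1) * l = l / (2*r+1) := by ring
  rw [b3] at b2
  rw [b5, b6, b7, hA0, b4]
  linarith

lemma core (g a c K : ℝ) (P : ℕ → ℝ) (N : ℕ) (hg : 1 ≤ g) (hc : 0 < c) (hca : c ≤ a)
    (ha3 : a ≤ 3) (hK : 0 < K) (hN : ∀ x, N ≤ x → P x = 0) (hP0 : ∀ x, 0 ≤ P x)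
    (hP : ∀ x : ℕ, P x ≤ K / Real.sqrt (2 * Real.pi * g) * Real.exp (-(x:ℝ)/(2*g)) * wInc x)
    (h1 : ∑ x ∈ Finset.range N, P x = 1) :
    (1/2) * Real.log (a*g) - 1/2 - Real.log K
      + a / (2*(a*g)+1) * (∑ x ∈ Finset.range N, P x * x)
      - (401 + 36 / Real.sqrt c) / Real.sqrt c * (∑ x ∈ Finset.range N, P x / Real.sqrt x) ≤
    discMI a P := by
  have ha : 0 < a := lt_of_lt_of_le hc hca
  have hg0 : 0 < g := by linarith
  have hPz : P 0 = 0 := by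
    apply le_antisymm _ (hP0 0)
    have := hP 0
    have e : wInc 0 = 0 := by
      have : Real.sqrt (-1) = 0 := Real.sqrt_eq_zero_of_nonpos (by norm_num)
      simp [wInc, this]
    rwa [e, mul_zero] at this
  have hsc : 0 < Real.sqrt c := Real.sqrt_pos.2 hc
  unfold discMI
  rw [tsum_eq_sum (s := Finset.range N)
      (fun x hx => by simp [hN x (by simpa using hx)])]
  set D := (401 + 36 / Real.sqrt c) / Real.sqrt c with hD
  have key : ∀ x ∈ Finset.range N, P x * ((1/2) * Real.log (a*g) - 1/2 - Real.log K)
      + a / (2*(a*g)+1) * (P x * x) - D * (P x / Real.sqrt x) ≤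
      ∑' z : ℕ, P x * poissonPMFr (a * x) z *
        Real.log (poissonPMFr (a * x) z / outMarg a P z) := by
    intro x hx
    rcases (hP0 x).eq_or_lt with h | hpos
    · rw [← h]; simp
    have hx0 : 0 < x := by
      rcases Nat.eq_zero_or_pos x with rfl | h
      · linarith
      · exact h
    have hxr : (0:ℝ) < x := by exact_mod_cast hx0
    have := per_x (a * x) (a*g) K (400 + 36 / Real.sqrt c) (P x) (outMarg a P) (by positivity)
      (by positivity) hK (by positivity) hpos ?_ (q_bound g a c K P N hg hc hca ha3 hK hN hP)
    · have h2 := mul_le_mul_of_nonneg_left this hpos.le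
      rw [← tsum_mul_left] at h2
      simp_rw [← mul_assoc] at h2
      refine le_trans ?_ h2
      have h3 : (400 + 36 / Real.sqrt c + 1) / Real.sqrt (a * x) ≤ D * (1 / Real.sqrt x) := by
        rw [hD, Real.sqrt_mul ha.le, ← div_div, mul_one_div]
        have : Real.sqrt c ≤ Real.sqrt a := Real.sqrt_le_sqrt hca
        rw [show 400 + 36 / Real.sqrt c + 1 = 401 + 36 / Real.sqrt c by ring]
        gcongr
      have h4 := mul_le_mul_of_nonneg_left h3 hpos.le
      have e1 : D * (P x / Real.sqrt x) = P x * (D * (1 / Real.sqrt x)) := by ring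
      have e2 : a / (2*(a*g)+1) * (P x * x) = P x * (a * x / (2 * (a*g)+1)) := by ring
      rw [e1, e2]
      have e3 : 2 * a * g = 2 * (a * g) := by ring
      try rw [e3]
      nlinarith
    · intro z
      unfold outMarg
      rw [tsum_eq_sum (s := Finset.range N)
        (fun x hx => by rw [hN x (by simpa using hx), zero_mul])]
      exact Finset.single_le_sum (f := fun y : ℕ => P y * poissonPMFr (a * y) z)
        (fun y _ => mul_nonneg (hP0 y) (by unfold poissonPMFr; positivity)) hx
  have := Finset.sum_le_sum key
  refine le_trans (le_of_eq ?_) this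
  rw [Finset.sum_sub_distrib, Finset.sum_add_distrib, ← Finset.sum_mul, h1, ← Finset.mul_sum,
    ← Finset.mul_sum]
  ring

/-- density of `gammaHalf g` -/
noncomputable def gdens (g u : ℝ) : ℝ := gammaPDFReal (1/2) (1/(2*g)) u

lemma gdens_nonneg (g : ℝ) (hg : 0 < g) (u : ℝ) : 0 ≤ gdens g u :=
  gammaPDFReal_nonneg (by norm_num) (by positivity) u

lemma gdens_eq (g : ℝ) (hg : 0 < g) (u : ℝ) (hu : 0 < u) :
    gdens g u = 1 / Real.sqrt (2 * Real.pi * g) * (u ^ (-(1/2) : ℝ) * Real.exp (-(1/(2*g) * u))) := by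
  unfold gdens gammaPDFReal
  rw [if_pos hu.le, Real.Gamma_one_half_eq, ← Real.sqrt_eq_rpow]
  have : Real.sqrt (1/(2*g)) / Real.sqrt Real.pi = 1 / Real.sqrt (2 * Real.pi * g) := by
    rw [← Real.sqrt_div (by positivity), one_div (Real.sqrt _), ← Real.sqrt_inv]
    congr 1; field_simp
  rw [this]
  norm_num
  ring

lemma gdens_moment (g : ℝ) (hg : 0 < g) (k : ℝ) (hk : 0 < k + 1/2) :
    IntegrableOn (fun u => u ^ k * gdens g u) (Set.Ioi 0) ∧
    ∫ u in Set.Ioi (0:ℝ), u ^ k * gdens g u =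
      1 / Real.sqrt (2 * Real.pi * g) * ((2*g) ^ (k + 1/2) * Real.Gamma (k + 1/2)) := by
  have e : ∀ u ∈ Set.Ioi (0:ℝ), 1 / Real.sqrt (2 * Real.pi * g) *
      (u ^ (k + 1/2 - 1) * Real.exp (-(1/(2*g) * u))) = u ^ k * gdens g u := by
    intro u hu
    have hu : 0 < u := hu
    rw [gdens_eq g hg u hu, show k + 1/2 - 1 = k + -(1/2) by ring, Real.rpow_add hu]
    ring
  constructor
  · have := integrableOn_rpow_mul_exp_neg_mul_rpow (p := 1) (s := k + 1/2 - 1) (b := 1/(2*g))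
      (by linarith) one_pos (by positivity)
    have h2 : IntegrableOn (fun u : ℝ => 1 / Real.sqrt (2 * Real.pi * g) *
      (u ^ (k + 1/2 - 1) * Real.exp (-(1/(2*g)) * u ^ (1:ℝ)))) (Set.Ioi 0) := this.const_mul _
    refine h2.congr_fun (fun u hu => ?_) measurableSet_Ioi
    rw [← e u hu]
    simp
  · rw [← setIntegral_congr_fun measurableSet_Ioi e, integral_const_mul,
      Real.integral_rpow_mul_exp_neg_mul_Ioi hk (by positivity)]
    simp

lemma gconst (g : ℝ) (hg : 0 < g) : 1 / Real.sqrt (2 * Real.pi * g) * (2*g)^((1:ℝ)/2) =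
    1 / Real.sqrt Real.pi := by
  rw [← Real.sqrt_eq_rpow, show 2 * Real.pi * g = (2 * g) * Real.pi by ring,
    Real.sqrt_mul (by positivity)]
  have : 0 < Real.sqrt (2 * g) := Real.sqrt_pos.2 (by positivity)
  field_simp

lemma gamma32 : Real.Gamma (3/2) = 1/2 * Real.sqrt Real.pi := by
  rw [show (3/2:ℝ) = 1/2 + 1 by norm_num, Real.Gamma_add_one (by norm_num), Real.Gamma_one_half_eq]

lemma gamma52 : Real.Gamma (5/2) = 3/4 * Real.sqrt Real.pi := by
  rw [show (5/2:ℝ) = 3/2 + 1 by norm_num, Real.Gamma_add_one (by norm_num), gamma32]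
  ring

lemma gdens_int0 (g : ℝ) (hg : 0 < g) : IntegrableOn (gdens g) (Set.Ioi 0) ∧
    ∫ u in Set.Ioi (0:ℝ), gdens g u = 1 := by
  have h := gdens_moment g hg 0 (by norm_num)
  simp only [Real.rpow_zero, one_mul, zero_add] at h
  refine ⟨h.1, ?_⟩
  rw [h.2, ← mul_assoc, gconst g hg, Real.Gamma_one_half_eq]
  have : 0 < Real.sqrt Real.pi := Real.sqrt_pos.2 Real.pi_pos
  field_simp

lemma gdens_int1 (g : ℝ) (hg : 0 < g) : IntegrableOn (fun u => u * gdens g u) (Set.Ioi 0) ∧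
    ∫ u in Set.Ioi (0:ℝ), u * gdens g u = g := by
  have h := gdens_moment g hg 1 (by norm_num)
  simp only [Real.rpow_one] at h
  refine ⟨h.1, ?_⟩
  rw [h.2, Real.rpow_add (by positivity), Real.rpow_one]
  have : 0 < Real.sqrt Real.pi := Real.sqrt_pos.2 Real.pi_pos
  have h2 := gconst g hg
  rw [show (1:ℝ) + 1/2 = 3/2 by norm_num, gamma32]
  calc _ = (1 / Real.sqrt (2 * Real.pi * g) * (2*g)^((1:ℝ)/2)) * (g * Real.sqrt Real.pi) := by ring
    _ = g := by rw [h2]; field_simp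

lemma gdens_int2 (g : ℝ) (hg : 0 < g) : IntegrableOn (fun u => u^2 * gdens g u) (Set.Ioi 0) ∧
    ∫ u in Set.Ioi (0:ℝ), u^2 * gdens g u = 3 * g^2 := by
  have h := gdens_moment g hg 2 (by norm_num)
  simp only [Real.rpow_two] at h
  refine ⟨h.1, ?_⟩
  rw [h.2, Real.rpow_add (by positivity), Real.rpow_two]
  have : 0 < Real.sqrt Real.pi := Real.sqrt_pos.2 Real.pi_pos
  have h2 := gconst g hg
  rw [show (2:ℝ) + 1/2 = 5/2 by norm_num, gamma52]
  calc _ = (1 / Real.sqrt (2 * Real.pi * g) * (2*g)^((1:ℝ)/2)) * (3 * g^2 * Real.sqrt Real.pi) := by ring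
    _ = 3 * g^2 := by rw [h2]; field_simp

lemma gdens_intm (g : ℝ) (hg : 0 < g) :
    IntegrableOn (fun u => u^(-(1/4):ℝ) * gdens g u) (Set.Ioi 0) ∧
    ∫ u in Set.Ioi (0:ℝ), u^(-(1/4):ℝ) * gdens g u =
      1 / Real.sqrt Real.pi * Real.Gamma (1/4) * (2*g)^(-(1/4):ℝ) := by
  have h := gdens_moment g hg (-(1/4)) (by norm_num)
  refine ⟨h.1, ?_⟩
  rw [h.2, Real.rpow_add (by positivity)]
  have h2 := gconst g hg
  rw [show -(1/4:ℝ) + 1/2 = 1/4 by norm_num, ← h2]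
  ring

lemma gammaHalf_real (g : ℝ) (hg : 0 < g) (A : Set ℝ) (hA : MeasurableSet A) :
    (gammaHalf g A).toReal = ∫ u in A, gdens g u := by
  unfold gammaHalf gammaMeasure
  rw [withDensity_apply _ hA, integral_eq_lintegral_of_nonneg_ae]
  · rfl
  · exact Filter.Eventually.of_forall (gdens_nonneg g hg)
  · exact (measurable_gammaPDFReal _ _).aestronglyMeasurable

lemma int_compare (S : Set ℝ) (hS : MeasurableSet S) (hS0 : S ⊆ Set.Ioi 0) (A B : ℝ → ℝ)
    (hA : IntegrableOn A (Set.Ioi 0)) (hB : IntegrableOn B (Set.Ioi 0))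
    (h1 : ∀ u ∈ S, A u ≤ B u) (h2 : ∀ u, 0 < u → u ∉ S → A u ≤ 0) :
    ∫ u in Set.Ioi (0:ℝ), A u ≤ ∫ u in S, B u := by
  have e : ∫ u in S, B u = ∫ u in Set.Ioi (0:ℝ), S.indicator B u := by
    rw [setIntegral_indicator hS, Set.inter_eq_right.2 hS0]
  rw [e]
  apply setIntegral_mono_on hA (hB.indicator hS) measurableSet_Ioi
  intro u hu
  by_cases hus : u ∈ S
  · rw [Set.indicator_of_mem hus]; exact h1 u hus
  · rw [Set.indicator_of_notMem hus]; exact h2 u hu hus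

lemma mass_lower (g l h : ℝ) (hg : 0 < g) (hl : 0 < l) (hl1 : l ≤ 1) (hh : 0 < h) :
    1 - 1 / Real.sqrt Real.pi * Real.Gamma (1/4) * (2*g)^(-(1/4):ℝ) - g / h ≤
      ∫ u in Set.Icc l h, gdens g u := by
  have i0 := gdens_int0 g hg
  have i1 := gdens_int1 g hg
  have im := gdens_intm g hg
  have := int_compare (Set.Icc l h) measurableSet_Icc (fun u hu => lt_of_lt_of_le hl hu.1)
    (fun u => gdens g u - u^(-(1/4):ℝ) * gdens g u - (1/h) * (u * gdens g u)) (gdens g)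
    ((i0.1.sub im.1).sub (i1.1.const_mul _)) i0.1 ?_ ?_
  · refine le_trans (le_of_eq ?_) this
    have hs : IntegrableOn (fun u => gdens g u - u^(-(1/4):ℝ) * gdens g u) (Set.Ioi 0) :=
      i0.1.sub im.1
    rw [integral_sub hs (i1.1.const_mul _), integral_sub i0.1 im.1,
      integral_const_mul, i0.2, i1.2, im.2]
    ring
  · intro u hu
    have hu0 : 0 < u := lt_of_lt_of_le hl hu.1
    have hd := gdens_nonneg g hg u
    have h1 : 0 ≤ u^(-(1/4):ℝ) * gdens g u := by positivity
    have h2 : 0 ≤ (1/h) * (u * gdens g u) := by positivity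
    linarith
  · intro u hu hus
    have hd := gdens_nonneg g hg u
    have h0 : 0 ≤ u^(-(1/4):ℝ) := by positivity
    have h3 : 0 ≤ u / h := by positivity
    have : 1 ≤ u^(-(1/4):ℝ) + u/h := by
      by_cases hul : u < l
      · have : 1 ≤ u^(-(1/4):ℝ) :=
          Real.one_le_rpow_of_pos_of_le_one_of_nonpos hu (by linarith) (by norm_num)
        linarith
      · have : h < u := by
          by_contra hcon
          exact hus ⟨not_lt.1 hul, not_lt.1 hcon⟩
        have : 1 ≤ u/h := by rw [le_div_iff₀ hh]; linarith
        linarith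
    have e : gdens g u - u^(-(1/4):ℝ) * gdens g u - (1/h) * (u * gdens g u) =
      (1 - (u^(-(1/4):ℝ) + u/h)) * gdens g u := by ring
    rw [e]
    exact mul_nonpos_of_nonpos_of_nonneg (by linarith) hd

lemma mean_lower (g l h : ℝ) (hg : 0 < g) (hl : 0 < l) (hl1 : l ≤ 1) (hh : 0 < h) :
    g - 1 - 3 * g^2 / h ≤ ∫ u in Set.Icc l h, u * gdens g u := by
  have i0 := gdens_int0 g hg
  have i1 := gdens_int1 g hg
  have i2 := gdens_int2 g hg
  have := int_compare (Set.Icc l h) measurableSet_Icc (fun u hu => lt_of_lt_of_le hl hu.1)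
    (fun u => u * gdens g u - gdens g u - (1/h) * (u^2 * gdens g u)) (fun u => u * gdens g u)
    ((i1.1.sub i0.1).sub (i2.1.const_mul _)) i1.1 ?_ ?_
  · refine le_trans (le_of_eq ?_) this
    have hs : IntegrableOn (fun u => u * gdens g u - gdens g u) (Set.Ioi 0) :=
      i1.1.sub i0.1
    rw [integral_sub hs (i2.1.const_mul _), integral_sub i1.1 i0.1,
      integral_const_mul, i0.2, i1.2, i2.2]
    ring
  · intro u hu
    have hd := gdens_nonneg g hg u
    have h2 : 0 ≤ (1/h) * (u^2 * gdens g u) := by positivity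
    linarith
  · intro u hu hus
    have hd := gdens_nonneg g hg u
    have h3 : 0 ≤ u^2 / h := by positivity
    have : u ≤ 1 + u^2/h := by
      by_cases hul : u < l
      · linarith
      · have : h < u := by
          by_contra hcon
          exact hus ⟨not_lt.1 hul, not_lt.1 hcon⟩
        have : u ≤ u^2/h := by rw [le_div_iff₀ hh]; nlinarith
        linarith
    have e : u * gdens g u - gdens g u - (1/h) * (u^2 * gdens g u) =
      (u - (1 + u^2/h)) * gdens g u := by ring
    rw [e]
    exact mul_nonpos_of_nonpos_of_nonneg (by linarith) hd

lemma mass_upper (g l h : ℝ) (hg : 0 < g) (hl : 0 < l) :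
    ∫ u in Set.Icc l h, gdens g u ≤ 1 := by
  have i0 := gdens_int0 g hg
  rw [← i0.2]
  apply setIntegral_mono_set i0.1
  · exact Filter.Eventually.of_forall (gdens_nonneg g hg)
  · exact Filter.Eventually.of_forall (fun u hu => lt_of_lt_of_le hl hu.1)

lemma cell_upper (g : ℝ) (hg : 0 < g) (k : ℕ) (hk : 1 ≤ k) :
    ∫ u in Set.Ioc ((k:ℝ)-1) k, gdens g u ≤
      Real.exp (1/(2*g)) / Real.sqrt (2 * Real.pi * g) * Real.exp (-(k:ℝ)/(2*g)) * wInc k := by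
  have hk1 : (1:ℝ) ≤ k := by exact_mod_cast hk
  have hsub : Set.Ioc ((k:ℝ)-1) k ⊆ Set.Ioi 0 := fun u hu => by
    have := hu.1
    show 0 < u
    linarith
  have hii : IntervalIntegrable (fun u : ℝ => u ^ (-(1/2):ℝ)) volume ((k:ℝ)-1) k :=
    intervalIntegral.intervalIntegrable_rpow' (by norm_num)
  have hi : IntegrableOn (fun u : ℝ => u ^ (-(1/2):ℝ)) (Set.Ioc ((k:ℝ)-1) k) :=
    (intervalIntegrable_iff_integrableOn_Ioc_of_le (by linarith)).1 hii
  set c0 := 1 / Real.sqrt (2 * Real.pi * g) * Real.exp (-((k:ℝ)-1)/(2*g)) with hc0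
  have h1 : ∫ u in Set.Ioc ((k:ℝ)-1) k, gdens g u ≤
      ∫ u in Set.Ioc ((k:ℝ)-1) k, c0 * u ^ (-(1/2):ℝ) := by
    apply setIntegral_mono_on ((gdens_int0 g hg).1.mono_set hsub) (hi.const_mul _) measurableSet_Ioc
    intro u hu
    have hu0 : 0 < u := hsub hu
    rw [gdens_eq g hg u hu0, hc0]
    have : Real.exp (-(1/(2*g) * u)) ≤ Real.exp (-((k:ℝ)-1)/(2*g)) := by
      apply Real.exp_le_exp.2
      have h2 : (1/(2*g)) * ((k:ℝ)-1) ≤ 1/(2*g) * u := by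
        apply mul_le_mul_of_nonneg_left hu.1.le (by positivity)
      have : -((k:ℝ)-1)/(2*g) = -((1/(2*g)) * ((k:ℝ)-1)) := by ring
      rw [this]; linarith
    have hup : 0 ≤ u ^ (-(1/2):ℝ) := by positivity
    calc _ ≤ 1 / Real.sqrt (2 * Real.pi * g) *
          (u ^ (-(1/2):ℝ) * Real.exp (-((k:ℝ)-1)/(2*g))) := by
          apply mul_le_mul_of_nonneg_left _ (by positivity)
          exact mul_le_mul_of_nonneg_left this hup
      _ = _ := by ring
  refine h1.trans (le_of_eq ?_)
  rw [integral_const_mul, ← intervalIntegral.integral_of_le (by linarith),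
    integral_rpow (Or.inl (by norm_num))]
  rw [show (-(1/2):ℝ)+1 = 1/2 by norm_num, ← Real.sqrt_eq_rpow, ← Real.sqrt_eq_rpow, hc0]
  have e : Real.exp (-((k:ℝ)-1)/(2*g)) = Real.exp (1/(2*g)) * Real.exp (-(k:ℝ)/(2*g)) := by
    rw [← Real.exp_add]; congr 1; ring
  rw [e]; unfold wInc; ring

lemma ceilset_meas (k : ℕ) : MeasurableSet {u : ℝ | ⌈u⌉₊ = k} :=
  Nat.measurable_ceil (measurableSet_singleton k)

lemma pmf_eq (g l h : ℝ) (hg : 0 < g) (k : ℕ) :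
    truncCeilPMF (gammaHalf g) (Set.Icc l h) k =
      (∫ u in Set.Icc l h, gdens g u)⁻¹ * ∫ u in Set.Icc l h ∩ {u | ⌈u⌉₊ = k}, gdens g u := by
  unfold truncCeilPMF
  rw [cond_apply measurableSet_Icc, ENNReal.toReal_mul, ENNReal.toReal_inv,
    gammaHalf_real g hg _ measurableSet_Icc,
    gammaHalf_real g hg _ (measurableSet_Icc.inter (ceilset_meas k))]

lemma cells_sum (l h : ℝ) (f : ℝ → ℝ) (hf : IntegrableOn f (Set.Icc l h)) :
    ∑ k ∈ Finset.range (⌈h⌉₊ + 1), ∫ u in Set.Icc l h ∩ {u | ⌈u⌉₊ = k}, f u =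
      ∫ u in Set.Icc l h, f u := by
  rw [← integral_biUnion_finset]
  · congr 2
    ext u
    simp only [Set.mem_iUnion, Finset.mem_range, Set.mem_inter_iff, Set.mem_ofPred_eq]
    constructor
    · rintro ⟨k, _, h1, _⟩; exact h1
    · intro hu
      exact ⟨⌈u⌉₊, Nat.lt_succ_of_le (Nat.ceil_mono hu.2), hu, rfl⟩
  · intro k _
    exact measurableSet_Icc.inter (ceilset_meas k)
  · intro i _ j _ hij
    apply Set.disjoint_left.2
    rintro u ⟨_, h1⟩ ⟨_, h2⟩
    exact hij (h1.symm.trans h2)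
  · intro k _
    exact hf.mono_set Set.inter_subset_left

lemma sqrt_sum (P : ℕ → ℝ) (N m : ℕ) (hm : 1 ≤ m) (B : ℝ) (hB0 : 0 ≤ B) (hP0 : ∀ x, 0 ≤ P x)
    (hB : ∀ x, P x ≤ B) (h1 : ∑ x ∈ Finset.range N, P x = 1) :
    ∑ x ∈ Finset.range N, P x / Real.sqrt x ≤ m * B + 1 / Real.sqrt m := by
  have hm1 : (1:ℝ) ≤ m := by exact_mod_cast hm
  have hsm : 0 < Real.sqrt m := Real.sqrt_pos.2 (by linarith)
  have hpt : ∀ x ∈ Finset.range N, P x / Real.sqrt x ≤ (if x < m then B else 0) + P x / Real.sqrt m := by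
    intro x _
    have h3 : 0 ≤ P x / Real.sqrt m := div_nonneg (hP0 x) hsm.le
    split_ifs with hx
    · rcases Nat.eq_zero_or_pos x with h0 | h0
      · subst h0; simp; linarith
      · have : (1:ℝ) ≤ Real.sqrt x := by
          rw [Real.one_le_sqrt]; exact_mod_cast h0
        have h4 : P x / Real.sqrt x ≤ P x := div_le_self (hP0 x) this
        linarith [hB x]
    · rw [zero_add]
      apply div_le_div_of_nonneg_left (hP0 x) hsm
      apply Real.sqrt_le_sqrt
      exact_mod_cast not_lt.1 hx
  refine (Finset.sum_le_sum hpt).trans ?_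
  rw [Finset.sum_add_distrib, ← Finset.sum_div, h1]
  have : ∑ x ∈ Finset.range N, (if x < m then B else 0) ≤ m * B := by
    rw [← Finset.sum_filter, Finset.sum_const, nsmul_eq_mul]
    apply mul_le_mul_of_nonneg_right _ hB0
    have : (Finset.filter (fun x => x < m) (Finset.range N)).card ≤ (Finset.range m).card := by
      apply Finset.card_le_card
      intro x hx
      simp at hx ⊢
      exact hx.2
    rw [Finset.card_range] at this
    exact_mod_cast this
  linarith

lemma pmf_bundle (g l h M : ℝ) (hg : 0 < g) (hl : 0 < l)
    (hM : M = ∫ u in Set.Icc l h, gdens g u) (hM0 : 0 < M) (hM1 : M ≤ 1) (P : ℕ → ℝ)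
    (hPd : P = truncCeilPMF (gammaHalf g) (Set.Icc l h)) :
    (∀ x, 0 ≤ P x) ∧ (∀ x, ⌈h⌉₊ + 1 ≤ x → P x = 0) ∧
    (∀ x : ℕ, P x ≤ (Real.exp (1/(2*g)) / M) / Real.sqrt (2 * Real.pi * g) *
      Real.exp (-(x:ℝ)/(2*g)) * wInc x) ∧
    ∑ x ∈ Finset.range (⌈h⌉₊ + 1), P x = 1 ∧
    ∫ u in Set.Icc l h, u * gdens g u ≤ ∑ x ∈ Finset.range (⌈h⌉₊ + 1), P x * x := by
  have hsub : Set.Icc l h ⊆ Set.Ioi 0 := fun u hu => lt_of_lt_of_le hl hu.1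
  have i0 := (gdens_int0 g hg).1.mono_set hsub
  have i1 := (gdens_int1 g hg).1.mono_set hsub
  have hP : ∀ k, P k = M⁻¹ * ∫ u in Set.Icc l h ∩ {u | ⌈u⌉₊ = k}, gdens g u := by
    intro k; rw [hPd, pmf_eq g l h hg k, ← hM]
  have hMi : 1 ≤ M⁻¹ := (one_le_inv₀ hM0).2 hM1
  have hnn : ∀ k : ℕ, 0 ≤ ∫ u in Set.Icc l h ∩ {u | ⌈u⌉₊ = k}, gdens g u := fun k =>
    integral_nonneg (gdens_nonneg g hg)
  refine ⟨fun x => ?_, fun x hx => ?_, fun x => ?_, ?_, ?_⟩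
  · rw [hP]; exact mul_nonneg (by positivity) (hnn x)
  · rw [hP]
    have : Set.Icc l h ∩ {u : ℝ | ⌈u⌉₊ = x} = ∅ := by
      ext u
      simp only [Set.mem_inter_iff, Set.mem_ofPred_eq, Set.mem_empty_iff_false, iff_false]
      rintro ⟨h1, h2⟩
      have := Nat.ceil_mono h1.2
      omega
    rw [this]; simp
  · rw [hP]
    rcases Nat.eq_zero_or_pos x with h0 | h0
    · have : Set.Icc l h ∩ {u : ℝ | ⌈u⌉₊ = x} = ∅ := by
        ext u
        simp only [Set.mem_inter_iff, Set.mem_ofPred_eq, Set.mem_empty_iff_false, iff_false]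
        rintro ⟨h1, h2⟩
        have h3 : 0 < u := hsub h1
        rw [h0] at h2
        have := Nat.ceil_eq_zero.1 h2
        linarith
      rw [this]
      have := (wInc_facts x).1
      simp only [Measure.restrict_empty, integral_zero_measure, mul_zero]
      positivity
    · have hs2 : Set.Icc l h ∩ {u : ℝ | ⌈u⌉₊ = x} ⊆ Set.Ioc ((x:ℝ)-1) x := by
        rintro u ⟨h1, h2⟩
        have h2 : ⌈u⌉₊ = x := h2
        have h3 : 0 < u := hsub h1
        have h4 := Nat.ceil_lt_add_one h3.le
        have h5 := Nat.le_ceil u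
        rw [h2] at h4 h5
        exact ⟨by linarith, h5⟩
      have hx1 : (1:ℝ) ≤ x := by exact_mod_cast h0
      have hs3 : Set.Ioc ((x:ℝ)-1) x ⊆ Set.Ioi 0 := fun u hu => by
        have := hu.1
        show 0 < u
        linarith
      have h6 : ∫ u in Set.Icc l h ∩ {u | ⌈u⌉₊ = x}, gdens g u ≤
          ∫ u in Set.Ioc ((x:ℝ)-1) x, gdens g u := by
        apply setIntegral_mono_set ((gdens_int0 g hg).1.mono_set hs3)
        · exact Filter.Eventually.of_forall (gdens_nonneg g hg)
        · exact Filter.Eventually.of_forall hs2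
      have h7 := h6.trans (cell_upper g hg x h0)
      calc _ ≤ M⁻¹ * _ := mul_le_mul_of_nonneg_left h7 (by positivity)
        _ = _ := by ring
  · rw [Finset.sum_congr rfl (fun k _ => hP k), ← Finset.mul_sum, cells_sum l h _ i0, ← hM]
    exact inv_mul_cancel₀ hM0.ne'
  · rw [← cells_sum l h _ i1]
    apply Finset.sum_le_sum
    intro k _
    have h8 : ∫ u in Set.Icc l h ∩ {u | ⌈u⌉₊ = k}, u * gdens g u ≤
        ∫ u in Set.Icc l h ∩ {u | ⌈u⌉₊ = k}, k * gdens g u := by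
      apply setIntegral_mono_on (i1.mono_set Set.inter_subset_left)
        ((i0.mono_set Set.inter_subset_left).const_mul _)
        (measurableSet_Icc.inter (ceilset_meas k))
      rintro u ⟨_, h2⟩
      have h2 : ⌈u⌉₊ = k := h2
      have h5 := Nat.le_ceil u
      rw [h2] at h5
      exact mul_le_mul_of_nonneg_right h5 (gdens_nonneg g hg u)
    rw [integral_const_mul] at h8
    rw [hP]
    refine h8.trans ?_
    have h9 : 0 ≤ (k:ℝ) * ∫ u in Set.Icc l h ∩ {u | ⌈u⌉₊ = k}, gdens g u :=
      mul_nonneg (by positivity) (hnn k)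
    nlinarith

lemma mean_arith (a c g y E : ℝ) (hg0 : 0 < g) (hc : 0 < c) (hca : c ≤ a) (hy0 : 0 ≤ y)
    (hEl : g * (1 - y) ≤ E) : 1/2 - 1/2*(1/(2*(c*g)) + y) ≤ a/(2*(a*g)+1) * E := by
  have ha : 0 < a := by linarith
  have hag : 0 < a * g := by positivity
  have hx : 1/2 - 1/2 * (1/(2*(c*g))) ≤ a*g/(2*(a*g)+1) := by
    rw [le_div_iff₀ (by positivity)]
    have : 1/(2*(a*g)) ≤ 1/(2*(c*g)) := by
      apply one_div_le_one_div_of_le (by positivity)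
      nlinarith
    have h2 : (1/2 - 1/2 * (1/(2*(a*g)))) * (2*(a*g)+1) ≤ a*g := by
      have : (1/2 - 1/2 * (1/(2*(a*g)))) * (2*(a*g)+1) = a*g - 1/(4*(a*g)) := by
        field_simp; ring
      rw [this]
      have : 0 ≤ 1/(4*(a*g)) := by positivity
      linarith
    refine le_trans (mul_le_mul_of_nonneg_right ?_ (by positivity)) h2
    linarith
  have hx2 : a*g/(2*(a*g)+1) ≤ 1/2 := by
    rw [div_le_iff₀ (by positivity)]; linarith
  have h3 : a*g/(2*(a*g)+1) * (1-y) ≤ a/(2*(a*g)+1) * E := by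
    calc _ = a/(2*(a*g)+1) * (g*(1-y)) := by ring
      _ ≤ _ := mul_le_mul_of_nonneg_left hEl (by positivity)
  have h4 := mul_le_mul_of_nonneg_right hx2 hy0
  linarith

/-- quantitative lower bound at a single `g` -/
lemma quant (g a c ρ : ℝ) (m : ℕ) (hm : 1 ≤ m) (hg : 1 ≤ g) (hc : 0 < c) (hca : c ≤ a) (ha3 : a ≤ 3)
    (hρ : 0 < ρ) (δ : ℝ) (hδ : δ = 1 / Real.sqrt Real.pi * Real.Gamma (1/4) * (2*g)^(-(1/4):ℝ) + g^(-ρ))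
    (hδ2 : δ ≤ 1/2) :
    (1/2) * Real.log (a*g) - (1/(2*g) + 2*δ + 1/2*(1/(2*(c*g)) + (1/g + 3*g^(-ρ))) +
      (401+36/Real.sqrt c)/Real.sqrt c * (m * (8 / Real.sqrt (2*Real.pi*g)) + 1/Real.sqrt m)) ≤
    discMI a (truncCeilPMF (gammaHalf g) (Set.Icc (g ^ (-(1 + 3 * ρ)) : ℝ) (g ^ ((1 : ℝ) + ρ)))) := by
  have hg0 : 0 < g := by linarith
  have ha : 0 < a := by linarith
  set l := g ^ (-(1 + 3 * ρ)) with hl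
  set h := g ^ ((1:ℝ) + ρ) with hh
  set P := truncCeilPMF (gammaHalf g) (Set.Icc l h) with hP
  have hl0 : 0 < l := by positivity
  have hl1 : l ≤ 1 := Real.rpow_le_one_of_one_le_of_nonpos hg (by linarith)
  have hh0 : 0 < h := by positivity
  have hgh : g / h = g^(-ρ) := by
    rw [hh, Real.rpow_add hg0, Real.rpow_one, Real.rpow_neg hg0.le]
    have : 0 < g^ρ := by positivity
    field_simp
  have hml := mass_lower g l h hg0 hl0 hl1 hh0
  have hmu := mass_upper g l h hg0 hl0
  have hmean := mean_lower g l h hg0 hl0 hl1 hh0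
  set M := ∫ u in Set.Icc l h, gdens g u with hM
  have hMd : 1 - δ ≤ M := by rw [hδ]; rw [hgh] at hml; linarith
  have hM0 : 0 < M := by linarith
  obtain ⟨b1, b2, b3, b4, b5⟩ := pmf_bundle g l h M hg0 hl0 hM hM0 hmu P hP
  set K := Real.exp (1/(2*g)) / M with hK
  have hK0 : 0 < K := by positivity
  have hcore := core g a c K P (⌈h⌉₊ + 1) hg hc hca ha3 hK0 b2 b1 b3 b4
  set E := ∑ x ∈ Finset.range (⌈h⌉₊ + 1), P x * x with hE
  have hK4 : K ≤ 4 := by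
    rw [hK, div_le_iff₀ hM0]
    have e1 : Real.exp (1/(2*g)) ≤ Real.exp (1/2) := by
      apply Real.exp_le_exp.2
      apply div_le_div_of_nonneg_left <;> linarith
    have e2 : Real.exp (1/2) ≤ 2 := by
      have := Real.exp_one_lt_three
      have e3 : Real.exp (1/2) * Real.exp (1/2) = Real.exp 1 := by
        rw [← Real.exp_add]; norm_num
      nlinarith [Real.exp_pos (1/2)]
    linarith
  have hlogK : Real.log K ≤ 1/(2*g) + 2*δ := by
    rw [hK, Real.log_div (Real.exp_pos _).ne' hM0.ne', Real.log_exp]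
    have h1 := Real.one_sub_inv_le_log_of_pos hM0
    have h2 : M⁻¹ ≤ 1 + 2*δ := by
      rw [inv_le_iff_one_le_mul₀ hM0]
      have : 0 ≤ δ := by linarith
      nlinarith
    linarith
  have hsq0 : 0 < Real.sqrt (2*Real.pi*g) := Real.sqrt_pos.2 (by positivity)
  have hB : ∀ x, P x ≤ 8 / Real.sqrt (2*Real.pi*g) := by
    intro x
    refine (b3 x).trans ?_
    have w := wInc_facts x
    have e1 : Real.exp (-(x:ℝ)/(2*g)) ≤ 1 := by
      apply Real.exp_le_one_iff.2
      apply div_nonpos_of_nonpos_of_nonneg _ (by positivity)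
      have : (0:ℝ) ≤ x := by positivity
      linarith
    calc K / Real.sqrt (2*Real.pi*g) * Real.exp (-(x:ℝ)/(2*g)) * wInc x
        ≤ 4 / Real.sqrt (2*Real.pi*g) * 1 * 2 := by
          have w1 := w.1
          have w2 := w.2.1
          gcongr
      _ = _ := by ring
  have hss := sqrt_sum P (⌈h⌉₊ + 1) m hm _ (by positivity) b1 hB b4
  have hsc : 0 < Real.sqrt c := Real.sqrt_pos.2 hc
  have hD := mul_le_mul_of_nonneg_left hss
    (show 0 ≤ (401+36/Real.sqrt c)/Real.sqrt c by positivity)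
  have hEl : g * (1 - (1/g + 3*g^(-ρ))) ≤ E := by
    refine le_trans (le_trans (le_of_eq ?_) hmean) b5
    rw [← hgh]; field_simp; ring
  have hE0 : 0 ≤ E := Finset.sum_nonneg (fun x _ => mul_nonneg (b1 x) (by positivity))
  have hmain : 1/2 - 1/2*(1/(2*(c*g)) + (1/g + 3*g^(-ρ))) ≤ a/(2*(a*g)+1) * E := by
    exact mean_arith a c g _ E hg0 hc hca (by positivity) hEl
  linarith

lemma Psi_nonneg (a : ℝ) (ha : 0 < a) : 0 ≤ Psi a := by
  unfold Psi binEnt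
  have h0 : 0 < 1/(a+1) := by positivity
  have h1 : 1/(a+1) ≤ 1 := by rw [div_le_one (by positivity)]; linarith
  have l1 : Real.log (1/(a+1)) ≤ 0 := Real.log_nonpos h0.le h1
  have l2 : Real.log (1 - 1/(a+1)) ≤ 0 := Real.log_nonpos (by linarith) (by linarith)
  apply mul_nonneg (by linarith)
  nlinarith

/-- limit of the error terms -/
lemma err_tendsto (c ρ D : ℝ) (hρ : 0 < ρ) (m : ℕ) :
    Tendsto (fun g : ℝ => 1 / Real.sqrt Real.pi * Real.Gamma (1/4) * (2*g)^(-(1/4):ℝ) + g^(-ρ))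
      atTop (nhds 0) ∧
    Tendsto (fun g : ℝ => 1/(2*g) + 2*(1 / Real.sqrt Real.pi * Real.Gamma (1/4) * (2*g)^(-(1/4):ℝ)
      + g^(-ρ)) + 1/2*(1/(2*(c*g)) + (1/g + 3*g^(-ρ))) +
      D * (m * (8 / Real.sqrt (2*Real.pi*g)))) atTop (nhds 0) := by
  have t2 : Tendsto (fun g : ℝ => 2*g) atTop atTop := tendsto_id.const_mul_atTop (by norm_num)
  have ti : Tendsto (fun g : ℝ => g⁻¹) atTop (nhds 0) := tendsto_inv_atTop_zero
  have a1 : Tendsto (fun g : ℝ => (2*g)^(-(1/4):ℝ)) atTop (nhds 0) :=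
    (tendsto_rpow_neg_atTop (by norm_num)).comp t2
  have a2 : Tendsto (fun g : ℝ => g^(-ρ)) atTop (nhds 0) := tendsto_rpow_neg_atTop hρ
  have a3 : Tendsto (fun g : ℝ => (Real.sqrt (2*Real.pi*g))⁻¹) atTop (nhds 0) := by
    apply tendsto_inv_atTop_zero.comp
    apply Real.tendsto_sqrt_atTop.comp
    exact tendsto_id.const_mul_atTop (by positivity)
  have b1 : Tendsto (fun g : ℝ => 1 / Real.sqrt Real.pi * Real.Gamma (1/4) * (2*g)^(-(1/4):ℝ)
      + g^(-ρ)) atTop (nhds 0) := by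
    simpa using (a1.const_mul (1 / Real.sqrt Real.pi * Real.Gamma (1/4))).add a2
  refine ⟨b1, ?_⟩
  have := (((ti.const_mul (1/2)).add (b1.const_mul 2)).add
    (((ti.const_mul (1/(2*c))).add (ti.add (a2.const_mul 3))).const_mul (1/2))).add
    (a3.const_mul (D * (m * 8)))
  simp only [mul_zero, add_zero] at this
  refine this.congr (fun g => ?_)
  simp only [one_div, mul_inv, div_eq_mul_inv]
  ring


/-- Prop. 3 of the paper: with `X̃ ~ Gam(1/2, 2 g_n)`, `X = ⌈X̃|_{S_n}⌉` for
`S_n = [g_n^{-(1+3ρ)}, g_n^{1+ρ}]` and `Z | X = x ~ Poi((r_n/g_n) x)`,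
`I(X;Z) ≥ (1/2) log r_n - Ψ(r_n/g_n) - ε` for all large `n`. -/
theorem truncated_gamma_MI (g r : ℕ → ℝ) (c : ℝ) (hc0 : 0 < c) (hce : c < Real.exp 1)
    (hgpos : ∀ n, 0 < g n) (hginf : Tendsto g atTop atTop)
    (hcr : ∀ n, c * g n ≤ r n) (hre : ∀ n, r n ≤ Real.exp 1 * g n)
    (ρ : ℝ) (hρ : ρ ∈ Set.Ioo (0 : ℝ) 1) (ε : ℝ) (hε : 0 < ε) :
    ∃ n₀ : ℕ, ∀ n ≥ n₀,
      (1 / 2) * Real.log (r n) - Psi (r n / g n) - ε ≤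
        discMI (r n / g n)
          (truncCeilPMF (gammaHalf (g n))
            (Set.Icc ((g n) ^ (-(1 + 3 * ρ)) : ℝ) ((g n) ^ ((1 : ℝ) + ρ)))) := by
  have hρ0 : 0 < ρ := hρ.1
  have hsc : 0 < Real.sqrt c := Real.sqrt_pos.2 hc0
  set D := (401+36/Real.sqrt c)/Real.sqrt c with hD
  have hD0 : 0 < D := by positivity
  obtain ⟨m, hm⟩ : ∃ m : ℕ, 1 ≤ m ∧ D * (1/Real.sqrt m) ≤ ε/2 := by
    have t : Tendsto (fun m : ℕ => D * (1/Real.sqrt (m:ℝ))) atTop (nhds 0) := by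
      have : Tendsto (fun m : ℕ => (Real.sqrt (m:ℝ))⁻¹) atTop (nhds 0) :=
        tendsto_inv_atTop_zero.comp (Real.tendsto_sqrt_atTop.comp tendsto_natCast_atTop_atTop)
      simpa using this.const_mul D
    have h1 := t.eventually (ge_mem_nhds (show (0:ℝ) < ε/2 by linarith))
    obtain ⟨m, h2, h3⟩ := (h1.and (eventually_ge_atTop 1)).exists
    exact ⟨m, h3, h2⟩
  obtain ⟨e1, e2⟩ := err_tendsto c ρ D hρ0 m
  have f1 := (e1.comp hginf).eventually (ge_mem_nhds (show (0:ℝ) < 1/2 by norm_num))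
  have f2 := (e2.comp hginf).eventually (ge_mem_nhds (show (0:ℝ) < ε/2 by linarith))
  have f3 := hginf.eventually (eventually_ge_atTop 1)
  obtain ⟨n₀, hn₀⟩ := eventually_atTop.1 (f1.and (f2.and f3))
  refine ⟨n₀, fun n hn => ?_⟩
  obtain ⟨h1, h2, h3⟩ := hn₀ n hn
  simp only [Function.comp] at h1 h2
  have hgn := hgpos n
  have hca : c ≤ r n / g n := by rw [le_div_iff₀ hgn]; exact hcr n
  have ha3 : r n / g n ≤ 3 := by
    rw [div_le_iff₀ hgn]
    have := Real.exp_one_lt_three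
    nlinarith [hre n]
  have hq := quant (g n) (r n / g n) c ρ m hm.1 h3 hc0 hca ha3 hρ0 _ rfl h1
  rw [div_mul_cancel₀ _ hgn.ne', ← hD, mul_add D] at hq
  have hPsi := Psi_nonneg (r n / g n) (by linarith)
  have hm2 := hm.2
  linarith
end

section
/- Let s ∈ ℕ with s ≥ 2, let r, g > 0, and let P_X be a probability mass function supported in {1,…,s}. Fix x = (x_1,…,x_n) ∈ {1,…,s}^n, let Z_1,…,Z_n be independent with Z_i ~ Poisson((r/g)·x_i), and define f_x(Z) := ∑_{i=1}^n log( P_{Z|X}(Z_i|x_i) / P_Z(Z_i) ). Then for every δ ∈ (0, (r/g)·s), P[ f_x(Z) < E[f_x(Z)] − n·δ ] ≤ exp( − n·g·δ² / (19·r·s·log²(s)) ). -/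
open Filter Set

/-- The information density `log (P_{Z|X}(z|x) / P_Z(z))` of the Poisson channel. -/
noncomputable def infoDens (a : ℝ) (P : ℕ → ℝ) (x z : ℕ) : ℝ :=
  Real.log (poissonPMFr (a * x) z / outMarg a P z)

open MeasureTheory ProbabilityTheory in
lemma aux_hasSum_mgf (l : NNReal) (c : ℝ) :
    HasSum (fun n : ℕ => Real.exp (-l) * (l:ℝ) ^ n / (n.factorial : ℝ) * Real.exp (c * n))
      (Real.exp (l * (Real.exp c - 1))) := by
  have h := (NormedSpace.expSeries_div_hasSum_exp ((l : ℝ) * Real.exp c)).mul_left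
    (Real.exp (-l))
  rw [← Real.exp_eq_exp_ℝ, ← Real.exp_add] at h
  convert! h using 1
  · funext n
    rw [mul_pow, ← Real.exp_nat_mul, mul_comm (n : ℝ) c]
    ring
  · congr 1; ring

open MeasureTheory ProbabilityTheory in
lemma aux_int_exp (l : NNReal) (c : ℝ) :
    Integrable (fun n : ℕ => Real.exp (c * n)) (poissonMeasure l) := by
  rw [integrable_poissonMeasure_iff]
  simpa using (aux_hasSum_mgf l c).summable

open MeasureTheory ProbabilityTheory in
lemma aux_mgf (l : NNReal) (c : ℝ) :
    ∫ n : ℕ, Real.exp (c * n) ∂(poissonMeasure l) = Real.exp (l * (Real.exp c - 1)) := by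
  rw [integral_poissonMeasure]
  simpa using (aux_hasSum_mgf l c).tsum_eq

open MeasureTheory ProbabilityTheory in
lemma aux_int_exp_f (l : NNReal) (f : ℕ → ℝ) (L : ℝ)
    (hf : ∀ z w : ℕ, |f z - f w| ≤ L * |(z:ℝ) - w|) (c : ℝ) :
    Integrable (fun n : ℕ => Real.exp (c * f n)) (poissonMeasure l) := by
  refine ((aux_int_exp l (|c| * L)).const_mul (Real.exp (c * f 0))).mono' .of_discrete ?_
  filter_upwards with z
  rw [Real.norm_eq_abs, Real.abs_exp, ← Real.exp_add, Real.exp_le_exp]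
  have h := hf z 0
  simp only [Nat.cast_zero, sub_zero, Nat.abs_cast] at h
  have h2 : c * (f z - f 0) ≤ |c| * (L * z) := by
    calc c * (f z - f 0) ≤ |c * (f z - f 0)| := le_abs_self _
      _ = |c| * |f z - f 0| := abs_mul _ _
      _ ≤ _ := by gcongr
  nlinarith

open MeasureTheory ProbabilityTheory in
lemma aux_int_f (l : NNReal) (f : ℕ → ℝ) (L : ℝ)
    (hf : ∀ z w : ℕ, |f z - f w| ≤ L * |(z:ℝ) - w|) :
    Integrable f (poissonMeasure l) := by
  refine ((aux_int_exp_f l f L hf 1).add (aux_int_exp_f l f L hf (-1))).mono' .of_discrete ?_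
  filter_upwards with z
  simp only [Pi.add_apply]
  rw [Real.norm_eq_abs, abs_le]
  have h1 := Real.add_one_le_exp (1 * f z)
  have h2 := Real.add_one_le_exp (-1 * f z)
  have h3 := Real.exp_pos (1 * f z)
  have h4 := Real.exp_pos (-1 * f z)
  constructor <;> linarith

open MeasureTheory ProbabilityTheory in
lemma aux_jensen (l : NNReal) (f : ℕ → ℝ) (L : ℝ)
    (hf : ∀ z w : ℕ, |f z - f w| ≤ L * |(z:ℝ) - w|) (θ : ℝ) :
    Real.exp (θ * ∫ z, f z ∂(poissonMeasure l)) ≤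
      ∫ z, Real.exp (θ * f z) ∂(poissonMeasure l) := by
  have h := convexOn_exp.map_integral_le (μ := poissonMeasure l) (f := fun z => θ * f z)
    Real.continuous_exp.continuousOn isClosed_univ (by simp)
    ((aux_int_f l f L hf).const_mul θ) (aux_int_exp_f l f L hf θ)
  rwa [integral_const_mul] at h

open MeasureTheory ProbabilityTheory in
lemma aux_symm (l : NNReal) (f : ℕ → ℝ) (L : ℝ)
    (hf : ∀ z w : ℕ, |f z - f w| ≤ L * |(z:ℝ) - w|) (θ : ℝ) :
    (∫ z, Real.exp (θ * f z) ∂(poissonMeasure l)) * (∫ z, Real.exp (-θ * f z) ∂(poissonMeasure l))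
     ≤ Real.exp (l * (2 * (Real.cosh (θ * L) - 1))) := by
  have key : ∀ (h : ℕ → ℝ) (c : ℝ),
      Integrable (fun n : ℕ => Real.exp (c * h n)) (poissonMeasure l) →
      Integrable (fun n : ℕ => Real.exp (-c * h n)) (poissonMeasure l) →
      Integrable (fun p : ℕ × ℕ => Real.cosh (c * (h p.1 - h p.2)))
        ((poissonMeasure l).prod (poissonMeasure l)) ∧
      ∫ p : ℕ × ℕ, Real.cosh (c * (h p.1 - h p.2)) ∂((poissonMeasure l).prod (poissonMeasure l))
      = (∫ z, Real.exp (c * h z) ∂(poissonMeasure l)) *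
        (∫ z, Real.exp (-c * h z) ∂(poissonMeasure l)) := by
    intro h c h1 h2
    have e : (fun p : ℕ × ℕ => Real.cosh (c * (h p.1 - h p.2))) =
        fun p => (1/2) * (Real.exp (c * h p.1) * Real.exp (-c * h p.2)) +
          (1/2) * (Real.exp (-c * h p.1) * Real.exp (c * h p.2)) := by
      funext p
      rw [Real.cosh_eq, ← Real.exp_add, ← Real.exp_add]
      ring_nf
    have i1 := (h1.mul_prod h2).const_mul (1/2)
    have i2 := (h2.mul_prod h1).const_mul (1/2)
    rw [e]
    refine ⟨i1.add i2, ?_⟩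
    rw [integral_add i1 i2, integral_const_mul, integral_const_mul,
      integral_prod_mul (fun z => Real.exp (c * h z)) (fun z => Real.exp (-c * h z)),
      integral_prod_mul (fun z => Real.exp (-c * h z)) (fun z => Real.exp (c * h z))]
    ring
  obtain ⟨i1, e1⟩ := key f θ (aux_int_exp_f l f L hf θ) (aux_int_exp_f l f L hf (-θ))
  obtain ⟨i2, e2⟩ := key (fun z => (z:ℝ)) (θ * L) (aux_int_exp l _) (aux_int_exp l _)
  rw [← e1]
  refine (integral_mono i1 i2 ?_).trans ?_
  · intro p
    rw [Real.cosh_le_cosh, abs_mul, abs_mul, abs_mul, mul_assoc]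
    gcongr
    refine (hf _ _).trans ?_
    gcongr
    exact le_abs_self L
  · rw [e2, aux_mgf, aux_mgf, ← Real.exp_add, Real.cosh_eq]
    apply le_of_eq
    congr 1
    ring

lemma aux_cosh (t : ℝ) (ht : t ^ 2 ≤ 1) : Real.cosh t - 1 ≤ t ^ 2 := by
  have h1 := Real.cosh_le_exp_half_sq t
  have h2 := Real.abs_exp_sub_one_le (x := t ^ 2 / 2) (by rw [abs_of_nonneg (by positivity)]; linarith)
  rw [abs_of_nonneg (a := t ^ 2 / 2) (by positivity)] at h2
  have := le_abs_self (Real.exp (t ^ 2 / 2) - 1)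
  linarith

open MeasureTheory ProbabilityTheory in
lemma aux_letter (l : NNReal) (f : ℕ → ℝ) (L : ℝ)
    (hf : ∀ z w : ℕ, |f z - f w| ≤ L * |(z:ℝ) - w|) (θ : ℝ) (ht : (θ * L) ^ 2 ≤ 1)
    (A : ℝ) (hA : (l : ℝ) ≤ A) :
    ∫ z, Real.exp (-θ * (f z - ∫ w, f w ∂(poissonMeasure l))) ∂(poissonMeasure l)
      ≤ Real.exp (2 * A * (θ * L) ^ 2) := by
  have e : ∀ z, Real.exp (-θ * (f z - ∫ w, f w ∂(poissonMeasure l))) =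
      Real.exp (θ * ∫ w, f w ∂(poissonMeasure l)) * Real.exp (-θ * f z) := by
    intro z
    rw [← Real.exp_add]; ring_nf
  simp_rw [e]
  rw [integral_const_mul]
  calc _ ≤ (∫ z, Real.exp (θ * f z) ∂(poissonMeasure l)) *
        (∫ z, Real.exp (-θ * f z) ∂(poissonMeasure l)) := by
        refine mul_le_mul_of_nonneg_right ?_ (integral_nonneg fun z => (Real.exp_pos _).le)
        exact aux_jensen l f L hf θ
    _ ≤ _ := aux_symm l f L hf θ
    _ ≤ _ := by
        rw [Real.exp_le_exp]
        have h1 := aux_cosh _ ht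
        have h0 : (0:ℝ) ≤ l := l.2
        calc (l:ℝ) * (2 * (Real.cosh (θ * L) - 1)) ≤ l * (2 * (θ * L) ^ 2) := by gcongr
          _ ≤ A * (2 * (θ * L) ^ 2) := by gcongr
          _ = _ := by ring

lemma aux_lip_of_succ (f : ℕ → ℝ) (L : ℝ) (h : ∀ z, |f (z + 1) - f z| ≤ L) (z w : ℕ) :
    |f z - f w| ≤ L * |(z:ℝ) - w| := by
  have key : ∀ w k : ℕ, |f (w + k) - f w| ≤ L * k := by
    intro w k
    induction k with
    | zero => simp
    | succ k ih =>
      have h1 := h (w + k)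
      have : f (w + (k + 1)) - f w = (f (w + k + 1) - f (w + k)) + (f (w + k) - f w) := by
        rw [add_assoc]; ring
      rw [this]
      refine (abs_add_le _ _).trans ?_
      push_cast
      linarith
  rcases le_total w z with hwz | hwz
  · obtain ⟨k, rfl⟩ := Nat.exists_eq_add_of_le hwz
    have := key w k
    push_cast
    rwa [add_sub_cancel_left, Nat.abs_cast]
  · obtain ⟨k, rfl⟩ := Nat.exists_eq_add_of_le hwz
    have := key z k
    push_cast
    rwa [sub_add_cancel_left, abs_neg, Nat.abs_cast, abs_sub_comm]

lemma aux_pois_succ (lam : ℝ) (z : ℕ) :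
    poissonPMFr lam (z + 1) = lam / (z + 1) * poissonPMFr lam z := by
  unfold poissonPMFr
  rw [Nat.factorial_succ]
  have : (z.factorial : ℝ) ≠ 0 := by positivity
  push_cast
  field_simp
  exact pow_succ' lam z

lemma aux_pois_pos (lam : ℝ) (h : 0 < lam) (z : ℕ) : 0 < poissonPMFr lam z := by
  unfold poissonPMFr; positivity

lemma aux_infoDens (s : ℕ) (hs : 2 ≤ s) (a : ℝ) (ha : 0 < a)
    (P : ℕ → ℝ) (hP0 : ∀ x, 0 ≤ P x) (hP1 : ∑' x, P x = 1)
    (hPsupp : ∀ x, P x ≠ 0 → 1 ≤ x ∧ x ≤ s) (x : ℕ) (hx : 1 ≤ x ∧ x ≤ s) (z : ℕ) :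
    |infoDens a P x (z + 1) - infoDens a P x z| ≤ Real.log s := by
  have hzero : ∀ y, y ∉ Finset.Icc 1 s → P y = 0 := by
    intro y hy
    by_contra h
    exact hy (Finset.mem_Icc.2 (hPsupp y h))
  have hq : ∀ z, outMarg a P z = ∑ y ∈ Finset.Icc 1 s, P y * poissonPMFr (a * y) z := by
    intro z
    exact tsum_eq_sum fun y hy => by rw [hzero y hy, zero_mul]
  rw [tsum_eq_sum (s := Finset.Icc 1 s) fun y hy => hzero y hy] at hP1
  have hpos : ∀ y ∈ Finset.Icc 1 s, ∀ z, 0 < poissonPMFr (a * y) z := by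
    intro y hy z
    have : (0:ℝ) < y := by exact_mod_cast (Finset.mem_Icc.1 hy).1
    exact aux_pois_pos _ (by positivity) z
  have hqpos : ∀ z, 0 < outMarg a P z := by
    intro z
    rw [hq]
    obtain ⟨y, hy, hne⟩ := Finset.exists_ne_zero_of_sum_ne_zero (by rw [hP1]; exact one_ne_zero)
    exact Finset.sum_pos' (fun y hy => mul_nonneg (hP0 y) (hpos y hy z).le)
      ⟨y, hy, mul_pos (lt_of_le_of_ne (hP0 y) (Ne.symm hne)) (hpos y hy z)⟩
  have hz : (0:ℝ) < z + 1 := by positivity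
  have hlo : a / (z + 1) * outMarg a P z ≤ outMarg a P (z + 1) := by
    rw [hq, hq, Finset.mul_sum]
    refine Finset.sum_le_sum fun y hy => ?_
    rw [aux_pois_succ]
    have h1 : (1:ℝ) ≤ y := by exact_mod_cast (Finset.mem_Icc.1 hy).1
    have h2 := mul_nonneg (hP0 y) (hpos y hy z).le
    calc a / (z + 1) * (P y * poissonPMFr (a * y) z)
        ≤ (a * y) / (z + 1) * (P y * poissonPMFr (a * y) z) := by
          gcongr
          nlinarith
      _ = _ := by ring
  have hhi : outMarg a P (z + 1) ≤ a * s / (z + 1) * outMarg a P z := by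
    rw [hq, hq, Finset.mul_sum]
    refine Finset.sum_le_sum fun y hy => ?_
    rw [aux_pois_succ]
    have h1 : (y:ℝ) ≤ s := by exact_mod_cast (Finset.mem_Icc.1 hy).2
    have h2 := mul_nonneg (hP0 y) (hpos y hy z).le
    calc _ = (a * y) / (z + 1) * (P y * poissonPMFr (a * y) z) := by ring
      _ ≤ a * s / (z + 1) * (P y * poissonPMFr (a * y) z) := by gcongr
  have hx1 : (1:ℝ) ≤ x := by exact_mod_cast hx.1
  have hxs : (x:ℝ) ≤ s := by exact_mod_cast hx.2
  have hp := hpos x (Finset.mem_Icc.2 hx)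
  have hs0 : (0:ℝ) < s := by linarith
  unfold infoDens
  rw [Real.log_div (hp _).ne' (hqpos _).ne', Real.log_div (hp _).ne' (hqpos _).ne',
    aux_pois_succ, Real.log_mul (by positivity) (hp _).ne']
  have l1 := Real.log_le_log (mul_pos (by positivity) (hqpos z)) hlo
  have l2 := Real.log_le_log (hqpos _) hhi
  rw [Real.log_mul (by positivity) (hqpos _).ne'] at l1 l2
  have hx0 : (0:ℝ) < x := by linarith
  rw [Real.log_div (by positivity) hz.ne', Real.log_mul ha.ne' hx0.ne']
  rw [Real.log_div (by positivity) hz.ne'] at l1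
  rw [Real.log_div (by positivity) hz.ne', Real.log_mul ha.ne' hs0.ne'] at l2
  have l3 := Real.log_le_log hx0 hxs
  have l4 := Real.log_nonneg hx1
  rw [abs_le]
  constructor <;> linarith

/-- Lemma 5 of the paper: conditional concentration of the information density
`f_x(Z) = ∑_i log (P_{Z|X}(Z_i|x_i)/P_Z(Z_i))` for independent `Z_i ~ Poi((r/g) x_i)`. -/
theorem info_density_concentration_z (s : ℕ) (hs : 2 ≤ s) (r g : ℝ) (hr : 0 < r) (hg : 0 < g)
    (P : ℕ → ℝ) (hP0 : ∀ x, 0 ≤ P x) (hP1 : ∑' x, P x = 1)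
    (hPsupp : ∀ x, P x ≠ 0 → 1 ≤ x ∧ x ≤ s)
    (n : ℕ) (x : Fin n → ℕ) (hx : ∀ i, 1 ≤ x i ∧ x i ≤ s)
    (δ : ℝ) (hδ0 : 0 < δ) (hδs : δ < r / g * s) :
    (∑' z : Fin n → ℕ,
        if (∑ i, infoDens (r / g) P (x i) (z i)) <
            (∑' w : Fin n → ℕ,
              (∏ i, poissonPMFr (r / g * x i) (w i)) *
                (∑ i, infoDens (r / g) P (x i) (w i))) - n * δ
        then ∏ i, poissonPMFr (r / g * x i) (z i) else 0)
      ≤ Real.exp (-(n : ℝ) * g * δ ^ 2 / (19 * r * s * (Real.log s) ^ 2)) := by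

  have ha : 0 < r / g := by positivity
  set a := r / g with ha_def
  have hs2 : (2:ℝ) ≤ s := by exact_mod_cast hs
  have hlog : Real.log 2 ≤ Real.log s := Real.log_le_log (by norm_num) hs2
  have hL : (0.69:ℝ) ≤ Real.log s := by have := Real.log_two_gt_d9; linarith
  set L := Real.log s with hL_def
  let l : Fin n → NNReal := fun i => ⟨a * x i, by positivity⟩
  let μ : Fin n → MeasureTheory.Measure ℕ := fun i => ProbabilityTheory.poissonMeasure (l i)
  have : ∀ i, MeasureTheory.IsProbabilityMeasure (μ i) := fun i => by
    simp only [μ]; infer_instance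
  let ν := MeasureTheory.Measure.pi μ
  have hsing : ∀ z : Fin n → ℕ, ν.real {z} = ∏ i, poissonPMFr (a * x i) (z i) := by
    intro z
    simp only [ν, MeasureTheory.measureReal_def]
    rw [MeasureTheory.Measure.pi_singleton, ENNReal.toReal_prod]
    refine Finset.prod_congr rfl fun i _ => ?_
    exact ProbabilityTheory.poissonMeasure_real_singleton (l i) (z i)
  let f : Fin n → ℕ → ℝ := fun i => infoDens a P (x i)
  have hf : ∀ i, ∀ z w : ℕ, |f i z - f i w| ≤ L * |(z:ℝ) - w| := fun i =>
    aux_lip_of_succ _ _ (aux_infoDens s hs a ha P hP0 hP1 hPsupp (x i) (hx i))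
  have hfi : ∀ i, MeasureTheory.Integrable (fun z : Fin n → ℕ => f i (z i)) ν := fun i =>
    MeasureTheory.integrable_comp_eval (μ := μ) (aux_int_f (l i) (f i) L (hf i))
  let m : Fin n → ℝ := fun i => ∫ w, f i w ∂(μ i)
  have hmean : (∑' w : Fin n → ℕ, (∏ i, poissonPMFr (a * x i) (w i)) *
      (∑ i, infoDens a P (x i) (w i))) = ∑ i, m i := by
    calc _ = ∫ z, ∑ i, f i (z i) ∂ν := by
          rw [MeasureTheory.integral_countable' (MeasureTheory.integrable_finset_sum _ fun i _ => hfi i)]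
          simp_rw [hsing]
          rfl
      _ = _ := by
          rw [MeasureTheory.integral_finset_sum _ fun i _ => hfi i]
          refine Finset.sum_congr rfl fun i _ => ?_
          exact MeasureTheory.integral_comp_eval (μ := μ) (f := f i) .of_discrete
  rw [hmean]
  let S : Set (Fin n → ℕ) := {z | ∑ i, infoDens a P (x i) (z i) < ∑ i, m i - n * δ}
  let θ := δ / (4 * (a * s) * L ^ 2)
  have hAs : 0 < a * s := by positivity
  have hL0 : 0 < L := by linarith
  have hθ0 : 0 < θ := by positivity
  have hθL : θ * L = δ / (4 * (a * s) * L) := by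
    simp only [θ]; field_simp
  have hθL1 : (θ * L) ^ 2 ≤ 1 := by
    have h1 : θ * L ≤ 1 := by
      rw [hθL, div_le_one (by positivity)]
      nlinarith
    have h0 : 0 ≤ θ * L := by positivity
    nlinarith
  let G : (Fin n → ℕ) → ℝ := fun z => ∏ i, Real.exp (-θ * (f i (z i) - m i))
  have hGi : MeasureTheory.Integrable G ν := by
    refine MeasureTheory.Integrable.fintype_prod (f := fun i z => Real.exp (-θ * (f i z - m i))) ?_
    intro i
    have e : (fun z => Real.exp (-θ * (f i z - m i))) =
        fun z => Real.exp (θ * m i) * Real.exp (-θ * f i z) := by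
      funext z
      rw [← Real.exp_add]; ring_nf
    rw [e]
    exact (aux_int_exp_f (l i) (f i) L (hf i) (-θ)).const_mul _
  have hG : ∫ z, G z ∂ν ≤ Real.exp (2 * (a * s) * (θ * L) ^ 2) ^ n := by
    simp only [G, ν]
    rw [MeasureTheory.integral_fintype_prod_eq_prod (fun i z => Real.exp (-θ * (f i z - m i)))]
    calc _ ≤ ∏ i : Fin n, Real.exp (2 * (a * s) * (θ * L) ^ 2) := by
          refine Finset.prod_le_prod
            (fun i _ => MeasureTheory.integral_nonneg fun z => (Real.exp_pos _).le) fun i _ => ?_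
          refine aux_letter (l i) (f i) L (hf i) θ hθL1 (a * s) ?_
          have : (x i : ℝ) ≤ s := by exact_mod_cast (hx i).2
          change a * x i ≤ a * s
          gcongr
      _ = _ := by simp
  have hSi : MeasureTheory.Integrable (S.indicator fun _ => (1:ℝ)) ν :=
    (MeasureTheory.integrable_const 1).indicator (MeasurableSet.of_discrete)
  have hLHS : (∑' z : Fin n → ℕ,
        if (∑ i, infoDens a P (x i) (z i)) < ∑ i, m i - n * δ
        then ∏ i, poissonPMFr (a * x i) (z i) else 0) = ∫ z, S.indicator (fun _ => (1:ℝ)) z ∂ν := by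
    rw [MeasureTheory.integral_countable' hSi]
    refine tsum_congr fun z => ?_
    rw [hsing]
    by_cases h : z ∈ S
    · rw [Set.indicator_of_mem h, smul_eq_mul, mul_one]
      exact if_pos h
    · rw [Set.indicator_of_notMem h, smul_eq_mul, mul_zero]
      exact if_neg h
  rw [hLHS]
  calc ∫ z, S.indicator (fun _ => (1:ℝ)) z ∂ν
      ≤ ∫ z, Real.exp (-θ * (n * δ)) * G z ∂ν := by
        refine MeasureTheory.integral_mono hSi (hGi.const_mul _) fun z => ?_
        have hGe : Real.exp (-θ * (n * δ)) * G z =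
            Real.exp (-θ * (n * δ + (∑ i, f i (z i) - ∑ i, m i))) := by
          simp only [G]
          rw [← Real.exp_sum, ← Real.exp_add, ← Finset.mul_sum, Finset.sum_sub_distrib]
          ring_nf
        simp only []
        rw [hGe]
        by_cases h : z ∈ S
        · rw [Set.indicator_of_mem h, Real.one_le_exp_iff]
          have h' : ∑ i, f i (z i) < ∑ i, m i - n * δ := h
          nlinarith
        · rw [Set.indicator_of_notMem h]
          exact (Real.exp_pos _).le
    _ = Real.exp (-θ * (n * δ)) * ∫ z, G z ∂ν := MeasureTheory.integral_const_mul _ _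
    _ ≤ Real.exp (-θ * (n * δ)) * Real.exp (2 * (a * s) * (θ * L) ^ 2) ^ n := by gcongr
    _ = Real.exp (-(n * δ ^ 2 / (8 * (a * s) * L ^ 2))) := by
        rw [← Real.exp_nat_mul, ← Real.exp_add, hθL]
        congr 1
        simp only [θ]
        field_simp
        ring
    _ ≤ _ := by
        rw [Real.exp_le_exp]
        have e : -(n:ℝ) * g * δ ^ 2 / (19 * r * s * L ^ 2) =
            -(n * δ ^ 2 / (19 * (a * s) * L ^ 2)) := by
          rw [ha_def]; field_simp
        rw [e]
        gcongr
        norm_num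
end

section
/- Let s ∈ ℕ₊, let r, g > 0 with r·s ≥ 12πe²·g, and let P_X be a probability mass function supported in {1,…,s}. Define J(x) := E[ log P_{Z|X}(Z|x) ] where Z ~ Poisson((r/g)·x), let X_1,…,X_n be i.i.d. with law P_X, and let H(Z) and I(X;Z) denote respectively the Shannon entropy of the output marginal P_Z and the mutual information of the single-letter pair (X,Z). Then for every δ > 0, P[ ∑_{i=1}^n J(X_i) + n·H(Z) < n·I(X;Z) − n·δ ] ≤ exp( − 2n·δ² / log²( (r·s)/g ) ). -/
open Filter Set

/-- Shannon entropy (in nats) of the output marginal. -/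
noncomputable def outEnt (a : ℝ) (P : ℕ → ℝ) : ℝ :=
  ∑' z : ℕ, Real.negMulLog (outMarg a P z)

/-- `J(x) = E[log P_{Z|X}(Z|x)]` for `Z ~ Poi(a x)`. -/
noncomputable def Jfun (a : ℝ) (x : ℕ) : ℝ :=
  ∑' z : ℕ, poissonPMFr (a * x) z * Real.log (poissonPMFr (a * x) z)

lemma pois_pos {lam : ℝ} (h : 0 < lam) (z : ℕ) : 0 < poissonPMFr lam z := by
  unfold poissonPMFr; positivity

lemma pois_sum (lam : ℝ) : HasSum (fun z => poissonPMFr lam z) 1 := by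
  have h := (NormedSpace.expSeries_div_hasSum_exp lam).mul_left (Real.exp (-lam))
  rw [← Real.exp_eq_exp_ℝ, ← Real.exp_add] at h
  simp only [neg_add_cancel, Real.exp_zero] at h
  refine h.congr_fun ?_
  intro z; unfold poissonPMFr; ring

lemma pois_succ (lam : ℝ) (z : ℕ) :
    poissonPMFr lam (z + 1) * ((z + 1 : ℕ) : ℝ) = lam * poissonPMFr lam z := by
  unfold poissonPMFr
  rw [Nat.factorial_succ]
  have : (z.factorial : ℝ) ≠ 0 := by positivity
  push_cast
  field_simp
  ring

lemma pois_m1 (lam : ℝ) : HasSum (fun z => poissonPMFr lam z * (z : ℝ)) lam := by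
  rw [← hasSum_nat_add_iff' 1]
  simp only [pois_succ]
  simpa using (pois_sum lam).mul_left lam

lemma pois_m2 (lam : ℝ) : HasSum (fun z => poissonPMFr lam z * (z : ℝ) ^ 2) (lam * (lam + 1)) := by
  rw [← hasSum_nat_add_iff' 1]
  have h := ((pois_m1 lam).add (pois_sum lam)).mul_left lam
  simp only [Finset.range_one, Finset.sum_singleton, Nat.cast_zero, ne_eq, OfNat.ofNat_ne_zero,
    not_false_eq_true, zero_pow, mul_zero, sub_zero]
  simp only [add_comm lam 1] at h ⊢
  refine h.congr_fun fun z => ?_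
  rw [pow_two, ← mul_assoc, pois_succ]
  push_cast; ring

lemma pois_le_one {lam : ℝ} (h : 0 < lam) (z : ℕ) : poissonPMFr lam z ≤ 1 :=
  le_hasSum (pois_sum lam) z (fun j _ => (pois_pos h j).le)

lemma log_fact (z : ℕ) : Real.log (z.factorial : ℝ) ≤
    1 + 1 / 2 * Real.log (z + 1) + z * Real.log z - z := by
  rcases z with _ | k
  · simp
  · have h := Stirling.stirlingSeq'_antitone (Nat.zero_le k)
    simp only [Function.comp, Nat.succ_eq_add_one, zero_add, Stirling.stirlingSeq_one] at h
    have h2 := Real.log_le_log (Stirling.stirlingSeq'_pos k) h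
    rw [Stirling.log_stirlingSeq_formula, Real.log_div (by positivity) (by positivity),
      Real.log_div (by positivity) (by positivity), Real.log_sqrt (by norm_num),
      Real.log_exp, Real.log_mul (by norm_num) (by positivity)] at h2
    have h3 : Real.log ((k + 1 : ℕ) : ℝ) ≤ Real.log ((k + 1 : ℕ) + 1) :=
      Real.log_le_log (by positivity) (by linarith)
    linarith

/-- upper bound for minus log of the pmf -/
noncomputable def bnd (lam : ℝ) (z : ℕ) : ℝ :=
  lam + 1 + 1 / 2 * (Real.log (lam + 1) + (z + 1) / (lam + 1) - 1) + (z : ℝ) ^ 2 / lam - 2 * z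

lemma log_tangent {c y : ℝ} (hc : 0 < c) (hy : 0 < y) : Real.log y ≤ Real.log c + y / c - 1 := by
  have := Real.log_le_sub_one_of_pos (div_pos hy hc)
  rw [Real.log_div hy.ne' hc.ne'] at this
  linarith

lemma neg_log_pois_le {lam : ℝ} (h : 0 < lam) (z : ℕ) :
    - Real.log (poissonPMFr lam z) ≤ bnd lam z := by
  have e : Real.log (poissonPMFr lam z) = -lam + z * Real.log lam - Real.log z.factorial := by
    unfold poissonPMFr
    rw [Real.log_div (by positivity) (by positivity), Real.log_mul (by positivity) (by positivity),
      Real.log_exp, Real.log_pow]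
  have h1 := log_fact z
  have h2 := log_tangent (c := lam + 1) (y := z + 1) (by linarith) (by positivity)
  have h3 : (z : ℝ) * Real.log z ≤ z * Real.log lam + (z : ℝ) ^ 2 / lam - z := by
    rcases Nat.eq_zero_or_pos z with rfl | hz
    · simp
    · have hz' : (0 : ℝ) < z := by exact_mod_cast hz
      have := mul_le_mul_of_nonneg_left (log_tangent h hz') hz'.le
      calc _ ≤ _ := this
        _ = _ := by ring
  rw [e]; unfold bnd
  linarith

lemma bnd_sum {lam : ℝ} (h : 0 < lam) :
    HasSum (fun z => poissonPMFr lam z * bnd lam z) (2 + 1 / 2 * Real.log (lam + 1)) := by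
  have a := (pois_sum lam).mul_right
    (lam + 1 + 1 / 2 * (Real.log (lam + 1) + 1 / (lam + 1) - 1))
  have b := (pois_m1 lam).mul_right (1 / 2 / (lam + 1) - 2)
  have c := (pois_m2 lam).mul_right (1 / lam)
  have e : 2 + 1 / 2 * Real.log (lam + 1) =
      1 * (lam + 1 + 1 / 2 * (Real.log (lam + 1) + 1 / (lam + 1) - 1)) +
      lam * (1 / 2 / (lam + 1) - 2) + lam * (lam + 1) * (1 / lam) := by
    have : lam + 1 ≠ 0 := by positivity
    field_simp; ring
  rw [e]
  refine ((a.add b).add c).congr_fun fun z => ?_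
  unfold bnd; ring

lemma plogp_summable {lam : ℝ} (h : 0 < lam) :
    Summable (fun z => poissonPMFr lam z * Real.log (poissonPMFr lam z)) := by
  refine Summable.of_neg (Summable.of_nonneg_of_le (fun z => ?_) (fun z => ?_) (bnd_sum h).summable)
  · have := Real.log_nonpos (pois_pos h z).le (pois_le_one h z)
    nlinarith [pois_pos h z]
  · have := mul_le_mul_of_nonneg_left (neg_log_pois_le h z) (pois_pos h z).le
    linarith

lemma J_nonpos (a : ℝ) (x : ℕ) (h : 0 < a * x) : Jfun a x ≤ 0 :=
  tsum_nonpos fun z => mul_nonpos_of_nonneg_of_nonpos (pois_pos h z).le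
    (Real.log_nonpos (pois_pos h z).le (pois_le_one h z))

lemma J_lower (a : ℝ) (x : ℕ) (h : 0 < a * x) :
    - (2 + 1 / 2 * Real.log (a * x + 1)) ≤ Jfun a x := by
  rw [← (bnd_sum h).neg.tsum_eq]
  refine (bnd_sum h).neg.summable.tsum_le_tsum (fun z => ?_) (plogp_summable h)
  have := mul_le_mul_of_nonneg_left (neg_log_pois_le h z) (pois_pos h z).le
  linarith

lemma J_lower' (a A : ℝ) (x : ℕ) (h : 0 < a * x) (hA : a * x ≤ A)
    (hA2 : 12 * Real.pi * Real.exp 2 ≤ A) : - Real.log A ≤ Jfun a x := by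
  refine le_trans ?_ (J_lower a x h)
  have hA0 : 0 < A := h.trans_le hA
  have h1 : Real.log (a * x + 1) ≤ Real.log (A + 1) := Real.log_le_log (by linarith) (by linarith)
  have he : (1 : ℝ) ≤ Real.exp 2 := Real.one_le_exp (by norm_num)
  have hpi := Real.pi_gt_three
  have h36 : 36 * Real.exp 2 ≤ A := by nlinarith
  have he2 : Real.exp 2 ≤ 9 := by
    have := Real.exp_one_lt_d9
    have e : Real.exp 2 = Real.exp 1 * Real.exp 1 := by rw [← Real.exp_add]; norm_num
    nlinarith [Real.exp_pos 1]
  have h2 : Real.exp 4 * (A + 1) ≤ A ^ 2 := by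
    have e : Real.exp 4 = Real.exp 2 * Real.exp 2 := by rw [← Real.exp_add]; norm_num
    have h5 : Real.exp 2 * Real.exp 2 ≤ A / 4 := by nlinarith
    have h6 := mul_le_mul_of_nonneg_right h5 (by linarith : 0 ≤ A + 1)
    rw [e]
    nlinarith
  have h3 := Real.log_le_log (by positivity) h2
  rw [Real.log_mul (by positivity) (by positivity), Real.log_exp, Real.log_pow] at h3
  push_cast at h3
  linarith

lemma hoeff (S : Finset ℕ) (P Y : ℕ → ℝ) (hP0 : ∀ x, 0 ≤ P x) (hP1 : ∑ x ∈ S, P x = 1)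
    (L : ℝ) (hY : ∀ x ∈ S, Y x ∈ Icc 0 L) (t : ℝ) :
    ∑ x ∈ S, P x * Real.exp (t * (Y x - ∑ x ∈ S, P x * Y x)) ≤ Real.exp (t ^ 2 * L ^ 2 / 8) := by
  let μ : MeasureTheory.Measure ℕ :=
    ∑ x ∈ S, ENNReal.ofReal (P x) • MeasureTheory.Measure.dirac x
  have hint : ∀ f : ℕ → ℝ, ∫ x, f x ∂μ = ∑ x ∈ S, P x * f x := by
    intro f
    rw [MeasureTheory.integral_finsetSum_measure]
    · refine Finset.sum_congr rfl fun x _ => ?_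
      rw [MeasureTheory.integral_smul_measure, MeasureTheory.integral_dirac,
        ENNReal.toReal_ofReal (hP0 x), smul_eq_mul]
    · intro i _
      exact (MeasureTheory.integrable_dirac (by simp)).smul_measure ENNReal.ofReal_ne_top
  have hprob : MeasureTheory.IsProbabilityMeasure μ := by
    constructor
    simp only [μ, MeasureTheory.Measure.finsetSum_apply, MeasureTheory.Measure.smul_apply,
      MeasureTheory.measure_univ, smul_eq_mul, mul_one]
    rw [← ENNReal.ofReal_sum_of_nonneg (fun i _ => hP0 i), hP1, ENNReal.ofReal_one]
  have hae : ∀ᵐ x ∂μ, Y x ∈ Icc 0 L := by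
    have : ∀ᵐ x ∂μ, x ∈ S := by
      rw [MeasureTheory.ae_iff]
      simp only [μ, MeasureTheory.Measure.finsetSum_apply, MeasureTheory.Measure.smul_apply]
      refine Finset.sum_eq_zero fun x hx => ?_
      simp [hx]
    filter_upwards [this] with x hx using hY x hx
  have key := (ProbabilityTheory.hasSubgaussianMGF_of_mem_Icc (μ := μ) (X := Y)
    (measurable_of_countable Y).aemeasurable hae).mgf_le t
  simp only [ProbabilityTheory.mgf, hint] at key
  refine key.trans (le_of_eq ?_)
  congr 1
  simp only [NNReal.coe_pow, NNReal.coe_div, coe_nnnorm, Real.norm_eq_abs, sub_zero,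
    NNReal.coe_ofNat, div_pow, sq_abs]
  ring

lemma mi_eq (a : ℝ) (ha : 0 < a) (S : Finset ℕ) (P : ℕ → ℝ) (hP0 : ∀ x, 0 ≤ P x)
    (hP1 : ∑ x ∈ S, P x = 1) (hS : ∀ x ∉ S, P x = 0) (hpos : ∀ x ∈ S, 1 ≤ x) :
    discMI a P = ∑ x ∈ S, P x * Jfun a x + outEnt a P := by
  have hl : ∀ x ∈ S, 0 < a * (x : ℝ) := fun x hx =>
    mul_pos ha (by exact_mod_cast hpos x hx)
  have hM : ∀ z, outMarg a P z = ∑ x ∈ S, P x * poissonPMFr (a * x) z := by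
    intro z
    exact tsum_eq_sum fun x hx => by simp [hS x hx]
  have hge : ∀ x ∈ S, ∀ z, P x * poissonPMFr (a * x) z ≤ outMarg a P z := by
    intro x hx z
    rw [hM]
    exact Finset.single_le_sum (f := fun x => P x * poissonPMFr (a * x) z)
      (fun i hi => mul_nonneg (hP0 i) (pois_pos (hl i hi) z).le) hx
  have hle : ∀ z, outMarg a P z ≤ 1 := by
    intro z
    rw [hM, ← hP1]
    refine Finset.sum_le_sum fun x hx => ?_
    have := mul_le_mul_of_nonneg_left (pois_le_one (hl x hx) z) (hP0 x)
    linarith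
  have hsum : ∀ x ∈ S, Summable (fun z => P x * poissonPMFr (a * x) z *
      Real.log (outMarg a P z)) := by
    intro x hx
    rcases (hP0 x).eq_or_lt with h0 | h0
    · simp [← h0, summable_zero]
    · have hb : Summable (fun z => P x * (poissonPMFr (a * x) z * (-Real.log (P x)) -
          poissonPMFr (a * x) z * Real.log (poissonPMFr (a * x) z))) :=
        (((pois_sum (a * x)).summable.mul_right _).sub (plogp_summable (hl x hx))).mul_left _
      have hpp : ∀ z, 0 < P x * poissonPMFr (a * x) z := fun z => mul_pos h0 (pois_pos (hl x hx) z)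
      refine Summable.of_neg (Summable.of_nonneg_of_le (fun z => ?_) (fun z => ?_) hb)
      · have h1 := Real.log_nonpos ((hpp z).le.trans (hge x hx z)) (hle z)
        nlinarith [hpp z]
      · have h1 := Real.log_le_log (hpp z) (hge x hx z)
        rw [Real.log_mul h0.ne' (pois_pos (hl x hx) z).ne'] at h1
        have := mul_le_mul_of_nonneg_left h1 (hpp z).le
        nlinarith
  have hH : outEnt a P = - ∑ x ∈ S, ∑' z, P x * poissonPMFr (a * x) z *
      Real.log (outMarg a P z) := by
    rw [← Summable.tsum_finsetSum hsum, ← tsum_neg]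
    unfold outEnt
    refine tsum_congr fun z => ?_
    rw [← Finset.sum_mul, ← hM, Real.negMulLog]
    ring
  have hI : discMI a P = ∑ x ∈ S, ∑' z : ℕ, P x * poissonPMFr (a * x) z *
      Real.log (poissonPMFr (a * x) z / outMarg a P z) :=
    tsum_eq_sum fun x hx => by simp [hS x hx]
  rw [hH, hI, ← sub_eq_add_neg, ← Finset.sum_sub_distrib]
  refine Finset.sum_congr rfl fun x hx => ?_
  unfold Jfun
  rw [← tsum_mul_left, ← Summable.tsum_sub ((plogp_summable (hl x hx)).mul_left _) (hsum x hx)]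
  refine tsum_congr fun z => ?_
  rcases (hP0 x).eq_or_lt with h0 | h0
  · simp [← h0]
  · have hp := pois_pos (hl x hx) z
    rw [Real.log_div hp.ne' ((mul_pos h0 hp).trans_le (hge x hx z)).ne']
    ring

/-- Lemma 6 of the paper: concentration of `∑_i J(X_i) + n H(Z)` around `n I(X;Z)`
for `X_1, …, X_n` i.i.d. with pmf `P`. -/
theorem info_density_concentration_x (s : ℕ) (hs : 0 < s) (r g : ℝ) (hr : 0 < r) (hg : 0 < g)
    (hrs : 12 * Real.pi * Real.exp 2 * g ≤ r * s)
    (P : ℕ → ℝ) (hP0 : ∀ x, 0 ≤ P x) (hP1 : ∑' x, P x = 1)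
    (hPsupp : ∀ x, P x ≠ 0 → 1 ≤ x ∧ x ≤ s)
    (n : ℕ) (δ : ℝ) (hδ : 0 < δ) :
    (∑' xv : Fin n → ℕ,
        if (∑ i, Jfun (r / g) (xv i)) + n * outEnt (r / g) P <
            n * discMI (r / g) P - n * δ
        then ∏ i, P (xv i) else 0)
      ≤ Real.exp (-2 * n * δ ^ 2 / (Real.log (r * s / g)) ^ 2) := by
  have ha : 0 < r / g := div_pos hr hg
  have hS : ∀ x ∉ Finset.Icc 1 s, P x = 0 := by
    intro x hx
    by_contra h
    exact hx (Finset.mem_Icc.2 (hPsupp x h))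
  have hP1' : ∑ x ∈ Finset.Icc 1 s, P x = 1 := by
    rw [← hP1, tsum_eq_sum hS]
  have hpos : ∀ x ∈ Finset.Icc 1 s, 1 ≤ x := fun x hx => (Finset.mem_Icc.1 hx).1
  have hmi := mi_eq (r / g) ha _ P hP0 hP1' hS hpos
  have hA : 12 * Real.pi * Real.exp 2 ≤ r * s / g := by rwa [le_div_iff₀ hg]
  have hL : 0 < Real.log (r * s / g) := by
    apply Real.log_pos
    have := Real.pi_gt_three
    have := Real.one_le_exp (x := 2) (by norm_num)
    nlinarith
  have hY : ∀ x ∈ Finset.Icc 1 s, - Jfun (r / g) x ∈ Icc 0 (Real.log (r * s / g)) := by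
    intro x hx
    have hx' := Finset.mem_Icc.1 hx
    have h1 : (0 : ℝ) < x := by exact_mod_cast hx'.1
    have h2 : (x : ℝ) ≤ s := by exact_mod_cast hx'.2
    have h3 : 0 < r / g * x := mul_pos ha h1
    have h4 : r / g * x ≤ r * s / g := by
      rw [mul_div_right_comm]
      exact mul_le_mul_of_nonneg_left h2 ha.le
    have := J_lower' _ _ x h3 h4 hA
    exact ⟨by linarith [J_nonpos _ x h3], by linarith⟩
  rw [hmi]
  generalize Real.log (r * s / g) = L at *
  generalize outEnt (r / g) P = H at *
  set S := Finset.Icc 1 s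
  have hh := hoeff S P (fun x => - Jfun (r / g) x) hP0 hP1' L hY (4 * δ / L ^ 2)
  generalize Jfun (r / g) = J at *
  set t := 4 * δ / L ^ 2 with ht
  have ht0 : 0 < t := by positivity
  set m := ∑ x ∈ S, P x * -J x with hm
  have hm' : ∑ x ∈ S, P x * J x = -m := by simp [hm]
  rw [hm', tsum_eq_sum (s := Fintype.piFinset fun _ : Fin n => S)]
  swap
  · intro xv hxv
    have : ∃ i, xv i ∉ S := by
      by_contra hcon
      push Not at hcon
      exact hxv (Fintype.mem_piFinset.2 hcon)
    obtain ⟨i, hi⟩ := this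
    rw [Finset.prod_eq_zero (Finset.mem_univ i) (hS _ hi), ite_self]
  calc _ ≤ ∑ xv ∈ Fintype.piFinset fun _ : Fin n => S, Real.exp (-(t * (n * δ))) *
        ∏ i, (P (xv i) * Real.exp (t * (-J (xv i) - m))) := by
        refine Finset.sum_le_sum fun xv _ => ?_
        rw [Finset.prod_mul_distrib, ← Real.exp_sum, mul_left_comm, ← Real.exp_add]
        have hp : 0 ≤ ∏ i, P (xv i) := Finset.prod_nonneg fun i _ => hP0 _
        split_ifs with hc
        · refine le_mul_of_one_le_right hp (Real.one_le_exp ?_)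
          rw [← Finset.mul_sum, Finset.sum_sub_distrib, Finset.sum_neg_distrib]
          simp only [Finset.sum_const, Finset.card_univ, Fintype.card_fin, nsmul_eq_mul]
          nlinarith
        · positivity
    _ = Real.exp (-(t * (n * δ))) * (∑ x ∈ S, P x * Real.exp (t * (-J x - m))) ^ n := by
        rw [← Finset.mul_sum, ← Finset.prod_univ_sum (fun _ : Fin n => S)
          (fun _ x => P x * Real.exp (t * (-J x - m)))]
        simp
    _ ≤ Real.exp (-(t * (n * δ))) * (Real.exp (t ^ 2 * L ^ 2 / 8)) ^ n := by
        have : 0 ≤ ∑ x ∈ S, P x * Real.exp (t * (-J x - m)) :=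
          Finset.sum_nonneg fun x _ => mul_nonneg (hP0 x) (Real.exp_pos _).le
        gcongr
    _ = _ := by
        rw [← Real.exp_nat_mul, ← Real.exp_add, ht]
        congr 1
        field_simp
        ring
end

section
/- Fix ρ ∈ (0,1). For g ≥ 1 let X̃ ~ Gam(1/2, 2g), and set s_min := g^{−(1+3ρ)} and s_max := g^{1+ρ}. Then: (i) s_max·P[ X̃ ≤ s_min ] ≤ g^{−ρ/2} for all g ≥ 1; and there exists g₀ (depending on ρ) such that for all g ≥ g₀: (ii) E[ X̃·log X̃ · 1{X̃ > s_max} ] ≤ exp(−g^ρ/4), and (iii) E[ X̃·log(1/s_min) · 1{X̃ > s_max} ] ≤ exp(−g^ρ/4). -/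
open Filter Set MeasureTheory ProbabilityTheory

lemma pref_le (g : ℝ) (hg : 1 ≤ g) :
    2 * ((1 / (2 * g)) ^ (1 / 2 : ℝ) / Real.Gamma (1 / 2)) ≤ g ^ (-(1 / 2) : ℝ) := by
  have g0 : 0 < g := by linarith
  rw [Real.Gamma_one_half_eq, ← Real.sqrt_eq_rpow, Real.rpow_neg g0.le, ← Real.sqrt_eq_rpow,
    ← Real.sqrt_inv, ← Real.sqrt_div (by positivity)]
  rw [show (2 : ℝ) = √4 by rw [show (4 : ℝ) = 2 ^ 2 by norm_num]; simp]
  rw [← Real.sqrt_mul (by norm_num)]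
  apply Real.sqrt_le_sqrt
  rw [show (√4 : ℝ) = 2 by rw [show (4 : ℝ) = 2 ^ 2 by norm_num]; simp]
  have hp := Real.pi_gt_three
  have : 4 * (1 / (2 * g) / Real.pi) = (2 / Real.pi) * g⁻¹ := by
    field_simp
    norm_num
  rw [this]
  have h2 : 2 / Real.pi ≤ 1 := by rw [div_le_one (by linarith)]; linarith
  have := inv_pos.mpr g0
  nlinarith

lemma cdf_bound (g s : ℝ) (hg : 1 ≤ g) (hs : 0 < s) :
    ((gammaHalf g) (Set.Iic s)).toReal ≤ g ^ (-(1 / 2) : ℝ) * s ^ (1 / 2 : ℝ) := by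
  have g0 : 0 < g := by linarith
  have hr : 0 < 1 / (2 * g) := by positivity
  have : IsProbabilityMeasure (gammaMeasure (1 / 2) (1 / (2 * g))) :=
    isProbabilityMeasure_gammaMeasure (by norm_num) hr
  have h := cdf_gammaMeasure_eq_integral (a := 1 / 2) (by norm_num) hr s
  rw [cdf_eq_real, measureReal_def] at h
  rw [gammaHalf, h]
  set c : ℝ := (1 / (2 * g)) ^ (1 / 2 : ℝ) / Real.Gamma (1 / 2) with hc
  have hc0 : 0 ≤ c := by positivity
  have hI : IntervalIntegrable (fun x : ℝ => c * x ^ (-(1 / 2) : ℝ)) volume 0 s :=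
    (intervalIntegral.intervalIntegrable_rpow' (by norm_num)).const_mul c
  rw [intervalIntegrable_iff_integrableOn_Ioc_of_le hs.le] at hI
  have hle : ∫ x in Iic s, gammaPDFReal (1 / 2) (1 / (2 * g)) x ≤
      ∫ x in Iic s, (Ioc 0 s).indicator (fun x : ℝ => c * x ^ (-(1 / 2) : ℝ)) x := by
    apply integral_mono_of_nonneg
    · exact ae_of_all _ fun x => gammaPDFReal_nonneg (by norm_num) hr x
    · exact ((integrable_indicator_iff measurableSet_Ioc).mpr hI).restrict
    · filter_upwards [ae_restrict_mem measurableSet_Iic] with x hx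
      rcases lt_trichotomy x 0 with h0 | h0 | h0
      · rw [indicator_of_notMem (by simp [h0.le]), gammaPDFReal, if_neg (by linarith)]
      · subst h0
        rw [indicator_of_notMem (by simp), gammaPDFReal, if_pos le_rfl,
          Real.zero_rpow (by norm_num)]
        simp
      · rw [indicator_of_mem (by exact ⟨h0, hx⟩), gammaPDFReal, if_pos h0.le]
        rw [show (1 / 2 - 1 : ℝ) = -(1 / 2) by norm_num]
        apply mul_le_of_le_one_right (by positivity)
        rw [Real.exp_le_one_iff]
        have : 0 ≤ 1 / (2 * g) * x := by positivity
        linarith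
  refine hle.trans ?_
  rw [setIntegral_indicator measurableSet_Ioc, inter_eq_right.mpr (fun x hx => hx.2),
    ← intervalIntegral.integral_of_le hs.le, intervalIntegral.integral_const_mul,
    integral_rpow (Or.inl (by norm_num)), show (-(1 / 2) + 1 : ℝ) = 1 / 2 by norm_num,
    Real.zero_rpow (by norm_num)]
  have hp := pref_le g hg
  rw [← hc] at hp
  have := Real.rpow_nonneg hs.le (1 / 2)
  nlinarith

lemma tail_bound (g S : ℝ) (hg : 1 ≤ g) (hS : 1 ≤ S) (f : ℝ → ℝ)
    (h0 : ∀ x, S < x → 0 ≤ f x) (h1 : ∀ x, S < x → f x ≤ 4 * g * x ^ (2 : ℝ)) :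
    ∫ x in {x : ℝ | S < x}, f x ∂(gammaHalf g) ≤
      4096 * g ^ 4 * Real.exp (-(3 / (8 * g) * S)) := by
  have g0 : 0 < g := by linarith
  have hr : 0 < 1 / (2 * g) := by positivity
  have hr8 : 0 < 1 / (8 * g) := by positivity
  have hms : MeasurableSet {x : ℝ | S < x} := measurableSet_Ioi
  have hmeas : Measurable (gammaPDF (1 / 2) (1 / (2 * g))) :=
    (measurable_gammaPDFReal _ _).ennreal_ofReal
  rw [gammaHalf, gammaMeasure, setIntegral_withDensity_eq_setIntegral_toReal_smul hmeas
    (ae_of_all _ fun x => ENNReal.ofReal_lt_top) f hms]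
  set K : ℝ := 4 * g * Real.exp (-(3 / (8 * g) * S)) with hK
  have hK0 : 0 ≤ K := by positivity
  have hint : IntegrableOn
      (fun x : ℝ => K * (x ^ ((3 : ℝ) - 1) * Real.exp (-(1 / (8 * g) * x)))) (Ioi 0) := by
    have := integrableOn_rpow_mul_exp_neg_mul_rpow (p := 1) (s := (3 : ℝ) - 1)
      (by norm_num) one_pos hr8
    simp only [Real.rpow_one, neg_mul] at this
    exact this.const_mul K
  have hsub : {x : ℝ | S < x} ⊆ Ioi 0 := fun x hx => by
    have : S < x := hx
    simp only [mem_Ioi]; linarith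
  have hc1 : (1 / (2 * g)) ^ (1 / 2 : ℝ) / Real.Gamma (1 / 2) ≤ 1 := by
    have h := pref_le g hg
    have h2 : g ^ (-(1 / 2) : ℝ) ≤ 1 := Real.rpow_le_one_of_one_le_of_nonpos hg (by norm_num)
    linarith
  calc _ ≤ ∫ x in {x : ℝ | S < x},
        K * (x ^ ((3 : ℝ) - 1) * Real.exp (-(1 / (8 * g) * x))) := by
        apply integral_mono_of_nonneg
        · filter_upwards [ae_restrict_mem hms] with x hx
          exact mul_nonneg ENNReal.toReal_nonneg (h0 x hx)
        · exact hint.mono_set hsub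
        · filter_upwards [ae_restrict_mem hms] with x hx
          have hx' : S < x := hx
          have hx0 : 0 < x := by linarith
          have hf0 := h0 x hx
          have hf1 := h1 x hx
          rw [smul_eq_mul, gammaPDF, ENNReal.toReal_ofReal
            (gammaPDFReal_nonneg (by norm_num) hr x), gammaPDFReal, if_pos hx0.le]
          have hxp : x ^ (1 / 2 - 1 : ℝ) ≤ 1 :=
            Real.rpow_le_one_of_one_le_of_nonpos (by linarith) (by norm_num)
          have hxp0 : 0 ≤ x ^ (1 / 2 - 1 : ℝ) := by positivity
          have he : Real.exp (-(1 / (2 * g) * x)) ≤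
              Real.exp (-(3 / (8 * g) * S)) * Real.exp (-(1 / (8 * g) * x)) := by
            rw [← Real.exp_add, Real.exp_le_exp]
            have e1 : 1 / (2 * g) * x = 3 / (8 * g) * x + 1 / (8 * g) * x := by
              field_simp; norm_num
            have : 3 / (8 * g) * S ≤ 3 / (8 * g) * x := by gcongr
            linarith
          calc _ ≤ (1 * 1 * (Real.exp (-(3 / (8 * g) * S)) * Real.exp (-(1 / (8 * g) * x))))
                * (4 * g * x ^ (2 : ℝ)) := by gcongr
            _ = _ := by
              rw [hK, show (3 - 1 : ℝ) = 2 by norm_num]; ring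
    _ ≤ ∫ x in Ioi 0, K * (x ^ ((3 : ℝ) - 1) * Real.exp (-(1 / (8 * g) * x))) := by
        apply setIntegral_mono_set hint
        · filter_upwards [ae_restrict_mem measurableSet_Ioi] with x hx
          have hx0 : 0 < x := hx
          simp only [Pi.zero_apply]
          positivity
        · exact hsub.eventuallyLE
    _ = _ := by
        rw [integral_const_mul, Real.integral_rpow_mul_exp_neg_mul_Ioi (by norm_num) hr8]
        have h3 : Real.Gamma 3 = 2 := by
          have := Real.Gamma_nat_eq_factorial 2
          norm_num at this
          simpa [Nat.factorial] using this
        rw [h3, one_div_one_div, show (3 : ℝ) = ((3 : ℕ) : ℝ) by norm_num, Real.rpow_natCast, hK]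
        push_cast
        ring

lemma eventually_small (ρ : ℝ) (hρ : 0 < ρ) :
    ∃ g₀ : ℝ, 1 ≤ g₀ ∧ ∀ g, g₀ ≤ g → 4096 * g ^ 4 * Real.exp (-(g ^ ρ) / 8) ≤ 1 := by
  have h := (tendsto_rpow_mul_exp_neg_mul_atTop_nhds_zero (4 / ρ) (1 / 8) (by norm_num)).comp
    (tendsto_rpow_atTop hρ)
  have h2 := h.eventually_le_const (show (0 : ℝ) < 1 / 4096 by norm_num)
  obtain ⟨a, ha⟩ := eventually_atTop.mp h2
  refine ⟨max a 1, le_max_right _ _, fun g hg => ?_⟩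
  have hg1 : 1 ≤ g := (le_max_right _ _).trans hg
  have h3 := ha g ((le_max_left _ _).trans hg)
  simp only [Function.comp] at h3
  rw [← Real.rpow_mul (by linarith), mul_div_cancel₀ _ hρ.ne',
    show (4 : ℝ) = ((4 : ℕ) : ℝ) by norm_num, Real.rpow_natCast,
    show -(1 / 8) * g ^ ρ = -(g ^ ρ) / 8 by ring] at h3
  linarith

/-- Lemma 8 of the paper: the three truncation-loss terms are negligible for
`X̃ ~ Gam(1/2, 2g)` with `s_min = g^{-(1+3ρ)}` and `s_max = g^{1+ρ}`. -/
theorem gamma_truncation_terms (ρ : ℝ) (hρ : ρ ∈ Set.Ioo (0 : ℝ) 1) :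
    (∀ g : ℝ, 1 ≤ g →
      (g ^ ((1 : ℝ) + ρ)) * ((gammaHalf g) (Set.Iic (g ^ (-(1 + 3 * ρ)) : ℝ))).toReal
        ≤ g ^ (-ρ / 2 : ℝ)) ∧
    ∃ g₀ : ℝ, ∀ g : ℝ, g₀ ≤ g →
      (∫ x in {x : ℝ | g ^ ((1 : ℝ) + ρ) < x}, x * Real.log x ∂(gammaHalf g))
          ≤ Real.exp (-(g ^ ρ) / 4) ∧
      (∫ x in {x : ℝ | g ^ ((1 : ℝ) + ρ) < x}, x * Real.log (1 / (g ^ (-(1 + 3 * ρ)) : ℝ))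
            ∂(gammaHalf g))
          ≤ Real.exp (-(g ^ ρ) / 4) := by
  obtain ⟨h0, h1⟩ := hρ
  refine ⟨fun g hg => ?_, ?_⟩
  · have g0 : 0 < g := by linarith
    have h := cdf_bound g (g ^ (-(1 + 3 * ρ))) hg (by positivity)
    calc _ ≤ g ^ (1 + ρ) * (g ^ (-(1 / 2) : ℝ) * (g ^ (-(1 + 3 * ρ))) ^ (1 / 2 : ℝ)) := by
          gcongr
      _ = _ := by
          rw [← Real.rpow_mul g0.le, ← Real.rpow_add g0, ← Real.rpow_add g0]
          congr 1
          ring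
  · obtain ⟨g₀, hg₀, H⟩ := eventually_small ρ h0
    refine ⟨g₀, fun g hg => ?_⟩
    have g1 : 1 ≤ g := hg₀.trans hg
    have g0 : 0 < g := by linarith
    have hS : 1 ≤ g ^ (1 + ρ) := Real.one_le_rpow g1 (by linarith)
    have hfin : 4096 * g ^ 4 * Real.exp (-(3 / (8 * g) * g ^ (1 + ρ))) ≤
        Real.exp (-(g ^ ρ) / 4) := by
      have e : -(3 / (8 * g) * g ^ (1 + ρ)) = -(g ^ ρ) / 8 + -(g ^ ρ) / 4 := by
        rw [Real.rpow_add g0, Real.rpow_one]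
        field_simp
        norm_num
      rw [e, Real.exp_add, ← mul_assoc]
      exact mul_le_of_le_one_left (Real.exp_pos _).le (H g hg)
    constructor
    · refine (tail_bound g _ g1 hS _ (fun x hx => ?_) (fun x hx => ?_)).trans hfin
      · exact mul_nonneg (by linarith) (Real.log_nonneg (by linarith))
      · have hx0 : 0 < x := by linarith
        have hl := Real.log_le_sub_one_of_pos hx0
        rw [Real.rpow_two]
        nlinarith [mul_nonneg (sub_nonneg.mpr g1) (sq_nonneg x)]
    · have hlog : Real.log (1 / (g ^ (-(1 + 3 * ρ)) : ℝ)) = (1 + 3 * ρ) * Real.log g := by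
        rw [one_div, Real.log_inv, Real.log_rpow g0]; ring
      have hlg := Real.log_nonneg g1
      have hl := Real.log_le_sub_one_of_pos g0
      simp only [hlog]
      refine (tail_bound g _ g1 hS _ (fun x hx => ?_) (fun x hx => ?_)).trans hfin
      · exact mul_nonneg (by linarith) (by positivity)
      · have hx1 : 1 ≤ x := by linarith
        have hb : (1 + 3 * ρ) * Real.log g ≤ 4 * g := by
          apply mul_le_mul <;> linarith
        rw [Real.rpow_two]
        have hxx : x ≤ x ^ 2 := by nlinarith
        calc _ ≤ x ^ 2 * (4 * g) := by
              apply mul_le_mul hxx hb (by positivity) (by positivity)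
          _ = _ := by ring
end

section
/- For every μ ≥ 0 and every probability mass function p on ℕ with mean ∑_{i∈ℕ} i·p(i) ≤ μ, the Shannon entropy ∑_{i∈ℕ} −p(i)·log p(i) is at most Ψ(μ) := (μ+1)·h_b(1/(μ+1)), and this bound is attained by the geometric distribution on ℕ with mean μ. Moreover, the function μ ↦ Ψ(μ) is monotone nondecreasing and concave on [0,∞). -/
open Filter Set

lemma Psi_eq (μ : ℝ) (h : 0 ≤ μ) :
    Psi μ = (μ + 1) * Real.log (μ + 1) - μ * Real.log μ := by
  rcases h.eq_or_lt with rfl | h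
  · simp [Psi, binEnt]
  · have h1 : 1 - 1 / (μ + 1) = μ / (μ + 1) := by field_simp; ring
    have h2 : μ + 1 ≠ 0 := by positivity
    unfold Psi binEnt
    rw [h1, Real.log_div h.ne' h2, Real.log_div one_ne_zero h2, Real.log_one]
    field_simp
    ring

lemma Psi_tangent (x t : ℝ) (hx : 0 ≤ x) (ht : 0 < t) :
    Psi x ≤ Real.log (t + 1) + x * (Real.log (t + 1) - Real.log t) := by
  rw [Psi_eq x hx]
  have ht1 : 0 < t + 1 := by positivity
  have hx1 : 0 < x + 1 := by positivity
  have hA := Real.log_le_sub_one_of_pos (div_pos hx1 ht1)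
  rw [Real.log_div hx1.ne' ht1.ne'] at hA
  rcases hx.eq_or_lt with rfl | hx
  · have := Real.log_nonneg (by linarith : (1 : ℝ) ≤ t + 1)
    simpa using this
  · have hB := Real.log_le_sub_one_of_pos
      (div_pos (mul_pos hx1 ht) (mul_pos ht1 hx))
    rw [Real.log_div (by positivity) (by positivity), Real.log_mul hx1.ne' ht.ne',
      Real.log_mul ht1.ne' hx.ne'] at hB
    have hB' := mul_le_mul_of_nonneg_left hB hx.le
    have e : x * ((x + 1) * t / ((t + 1) * x) - 1) = - ((x + 1) / (t + 1) - 1) := by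
      field_simp
      ring
    rw [e] at hB'
    nlinarith

lemma Psi_tangent_eq (t : ℝ) (ht : 0 < t) :
    Psi t = Real.log (t + 1) + t * (Real.log (t + 1) - Real.log t) := by
  rw [Psi_eq t ht.le]; ring

lemma slope_nonneg (t : ℝ) (ht : 0 < t) : 0 ≤ Real.log (t + 1) - Real.log t :=
  sub_nonneg.2 (Real.log_le_log ht (by linarith))

lemma gibbs (p q : ℝ) (hp : 0 ≤ p) (hq : 0 < q) :
    Real.negMulLog p ≤ -p * Real.log q + q - p := by
  rcases hp.eq_or_lt with rfl | hp
  · simp [hq.le]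
  · have h := Real.log_le_sub_one_of_pos (div_pos hq hp)
    rw [Real.log_div hq.ne' hp.ne'] at h
    have h' := mul_le_mul_of_nonneg_left h hp.le
    have e : p * (q / p - 1) = q - p := by field_simp
    rw [e] at h'
    unfold Real.negMulLog
    linarith

lemma log_geom (μ : ℝ) (h : 0 < μ) (i : ℕ) :
    Real.log ((1 / (μ + 1)) * (1 - 1 / (μ + 1)) ^ i) =
      -(Real.log (μ + 1) + i * (Real.log (μ + 1) - Real.log μ)) := by
  have h1 : 1 - 1 / (μ + 1) = μ / (μ + 1) := by field_simp; ring
  rw [h1, Real.log_mul (by positivity) (by positivity), Real.log_pow,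
    Real.log_div one_ne_zero (by positivity), Real.log_div h.ne' (by positivity), Real.log_one]
  ring

lemma ratio_mem (μ : ℝ) (h : 0 < μ) : 0 < 1 - 1 / (μ + 1) ∧ 1 - 1 / (μ + 1) < 1 := by
  have h1 : 1 - 1 / (μ + 1) = μ / (μ + 1) := by field_simp; ring
  constructor
  · rw [h1]; positivity
  · have : 0 < 1 / (μ + 1) := by positivity
    linarith

lemma hasSum_geom (μ : ℝ) (h : 0 < μ) :
    HasSum (fun i : ℕ => (1 / (μ + 1)) * (1 - 1 / (μ + 1)) ^ i) 1 := by
  have hr := ratio_mem μ h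
  have := (hasSum_geometric_of_lt_one hr.1.le hr.2).mul_left (1 / (μ + 1))
  have e : (1 / (μ + 1)) * (1 - (1 - 1 / (μ + 1)))⁻¹ = 1 := by
    rw [sub_sub_cancel, mul_inv_cancel₀ (by positivity)]
  rw [e] at this
  exact this

lemma hasSum_geom_mean (μ : ℝ) (h : 0 < μ) :
    HasSum (fun i : ℕ => (i : ℝ) * ((1 / (μ + 1)) * (1 - 1 / (μ + 1)) ^ i)) μ := by
  have hr := ratio_mem μ h
  have := (hasSum_coe_mul_geometric_of_norm_lt_one (r := 1 - 1 / (μ + 1))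
    (by rw [Real.norm_eq_abs, abs_of_pos hr.1]; exact hr.2)).mul_left (1 / (μ + 1))
  have e : (1 / (μ + 1)) * ((1 - 1 / (μ + 1)) / (1 - (1 - 1 / (μ + 1))) ^ 2) = μ := by
    rw [sub_sub_cancel]; field_simp; ring
  rw [e] at this
  have e2 : (fun i : ℕ => (i : ℝ) * ((1 / (μ + 1)) * (1 - 1 / (μ + 1)) ^ i)) =
      fun i : ℕ => (1 / (μ + 1)) * ((i : ℝ) * (1 - 1 / (μ + 1)) ^ i) := by
    funext i; ring
  rw [e2]
  exact this

/-- The geometric distribution on `ℕ` with mean `μ` maximizes Shannon entropy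
among pmfs on `ℕ` with mean at most `μ`, achieving `Ψ(μ)`; moreover `Ψ` is
nondecreasing and concave on `[0,∞)`. -/
theorem max_entropy_geometric :
    (∀ μ : ℝ, 0 ≤ μ → ∀ p : ℕ → ℝ, (∀ i, 0 ≤ p i) → (∑' i, p i) = 1 →
      Summable (fun i : ℕ => (i : ℝ) * p i) → (∑' i : ℕ, (i : ℝ) * p i) ≤ μ →
      (∑' i : ℕ, Real.negMulLog (p i)) ≤ Psi μ) ∧
    (∀ μ : ℝ, 0 ≤ μ →
      (∑' i : ℕ, Real.negMulLog ((1 / (μ + 1)) * (1 - 1 / (μ + 1)) ^ i)) = Psi μ) ∧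
    MonotoneOn Psi (Set.Ici 0) ∧ ConcaveOn ℝ (Set.Ici 0) Psi := by
  refine ⟨?_, ?_, ?_, ?_⟩
  · intro μ hμ p hp h1 hs hm
    have hps : Summable p := by
      by_contra hc
      rw [tsum_eq_zero_of_not_summable hc] at h1
      exact zero_ne_one h1
    rcases hμ.eq_or_lt with rfl | hμ
    · have hz : ∀ i, i ≠ 0 → p i = 0 := by
        intro i hi
        have h := hs.le_tsum i (fun j _ => mul_nonneg (Nat.cast_nonneg j) (hp j))
        have hi' : (0 : ℝ) < i := by exact_mod_cast Nat.pos_of_ne_zero hi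
        have h2 : (i : ℝ) * p i ≤ 0 := h.trans hm
        have := hp i
        nlinarith
      have h0 : p 0 = 1 := by rw [← h1, tsum_eq_single 0 hz]
      have : ∀ i, Real.negMulLog (p i) = 0 := by
        intro i
        by_cases hi : i = 0
        · simp [hi, h0]
        · simp [hz i hi]
      simp [this, Psi, binEnt]
    · have hnn : ∀ i, 0 ≤ Real.negMulLog (p i) := fun i =>
        Real.negMulLog_nonneg (hp i) (h1 ▸ hps.le_tsum i (fun j _ => hp j))
      have hr := ratio_mem μ hμ
      have hb : ∀ i, Real.negMulLog (p i) ≤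
          Real.log (μ + 1) * p i + (Real.log (μ + 1) - Real.log μ) * ((i : ℝ) * p i)
            + (1 / (μ + 1)) * (1 - 1 / (μ + 1)) ^ i - p i := by
        intro i
        have h := gibbs (p i) ((1 / (μ + 1)) * (1 - 1 / (μ + 1)) ^ i) (hp i)
          (mul_pos (by positivity) (pow_pos hr.1 i))
        rw [log_geom μ hμ] at h
        linarith
      have hp1 : HasSum p 1 := h1 ▸ hps.hasSum
      have hS := (((hp1.mul_left (Real.log (μ + 1))).add
        (hs.hasSum.mul_left (Real.log (μ + 1) - Real.log μ))).add (hasSum_geom μ hμ)).sub hp1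
      have hsum := Summable.of_nonneg_of_le hnn hb hS.summable
      have := hasSum_le hb hsum.hasSum hS
      have h3 := mul_le_mul_of_nonneg_left hm (slope_nonneg μ hμ)
      rw [Psi_tangent_eq μ hμ]
      linarith
  · intro μ hμ
    rcases hμ.eq_or_lt with rfl | hμ
    · have : ∀ i : ℕ, Real.negMulLog ((1 / ((0 : ℝ) + 1)) * (1 - 1 / (0 + 1)) ^ i) = 0 := by
        intro i
        by_cases hi : i = 0
        · simp [hi]
        · simp [hi]
      simp only [this]
      simp [Psi, binEnt]
    · have hS := ((hasSum_geom μ hμ).mul_left (Real.log (μ + 1))).add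
        ((hasSum_geom_mean μ hμ).mul_left (Real.log (μ + 1) - Real.log μ))
      rw [Psi_tangent_eq μ hμ]
      have e := hS.tsum_eq
      rw [mul_one, mul_comm _ μ] at e
      rw [← e]
      refine tsum_congr fun i => ?_
      rw [Real.negMulLog, log_geom μ hμ]
      ring
  · intro x hx y hy hxy
    simp only [Set.mem_Ici] at hx hy
    rcases hy.eq_or_lt with rfl | hy
    · rw [le_antisymm hxy hx]
    · rw [Psi_tangent_eq y hy]
      have h3 := mul_le_mul_of_nonneg_right hxy (slope_nonneg y hy)
      have := Psi_tangent x y hx hy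
      linarith
  · refine ⟨convex_Ici 0, ?_⟩
    intro x hx y hy a b ha hb hab
    simp only [Set.mem_Ici] at hx hy
    simp only [smul_eq_mul]
    have hz : 0 ≤ a * x + b * y := by positivity
    rcases hz.eq_or_lt with hz | hz
    · have hax : a * x = 0 := by nlinarith [mul_nonneg ha hx, mul_nonneg hb hy]
      have hby : b * y = 0 := by nlinarith [mul_nonneg ha hx, mul_nonneg hb hy]
      have h0 : Psi 0 = 0 := by simp [Psi, binEnt]
      have e1 : a * Psi x = 0 := by
        rcases mul_eq_zero.1 hax with h | h <;> simp [h, h0]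
      have e2 : b * Psi y = 0 := by
        rcases mul_eq_zero.1 hby with h | h <;> simp [h, h0]
      rw [e1, e2, ← hz, h0]; simp
    · rw [Psi_tangent_eq _ hz]
      have k1 := mul_le_mul_of_nonneg_left (Psi_tangent x _ hx hz) ha
      have k2 := mul_le_mul_of_nonneg_left (Psi_tangent y _ hy hz) hb
      refine (add_le_add k1 k2).trans (le_of_eq ?_)
      obtain rfl : b = 1 - a := by linarith
      ring
end
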